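/- arXiv:1504.04422 — 2 statements merged into one kernel-verified Lean document; each statement's English description precedes it below -/
import Mathlib

section
/- Let Γ be a finite connected non-complete graph of prime valency p that is 2-geodesic transitive but not 2-arc transitive. Then Aut Γ is isomorphic to the direct product Z_2 × PSL(2,p), where PSL(2,p) is the projective special linear group of 2×2 matrices over the field with p elements; in particular |Aut Γ| = p(p+1)(p-1). -/
open SimpleGraph

/-- `Γ` is arc transitive: its automorphism group is transitive on ordered pairs
of adjacent vertices. -/
def ArcTransitive {V : Type*} (Γ : SimpleGraph V) : Prop :=
  ∀ ⦃v u v' u' : V⦄, Γ.Adj v u → Γ.Adj v' u' →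
    ∃ φ : Γ ≃g Γ, φ v = v' ∧ φ u = u'

/-- `(v,u,w)` is a 2-arc of `Γ`. -/
def Is2Arc {V : Type*} (Γ : SimpleGraph V) (v u w : V) : Prop :=
  Γ.Adj v u ∧ Γ.Adj u w ∧ v ≠ w

/-- `(v,u,w)` is a 2-geodesic of `Γ`: a 2-arc with `v`, `w` non-adjacent. -/
def Is2Geodesic {V : Type*} (Γ : SimpleGraph V) (v u w : V) : Prop :=
  Γ.Adj v u ∧ Γ.Adj u w ∧ v ≠ w ∧ ¬ Γ.Adj v w

/-- `Γ` is 2-arc transitive: arc transitive and transitive on 2-arcs. -/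
def TwoArcTransitive {V : Type*} (Γ : SimpleGraph V) : Prop :=
  ArcTransitive Γ ∧
  ∀ ⦃v u w v' u' w' : V⦄, Is2Arc Γ v u w → Is2Arc Γ v' u' w' →
    ∃ φ : Γ ≃g Γ, φ v = v' ∧ φ u = u' ∧ φ w = w'

/-- `Γ` is 2-geodesic transitive: arc transitive and transitive on 2-geodesics. -/
def TwoGeodesicTransitive {V : Type*} (Γ : SimpleGraph V) : Prop :=
  ArcTransitive Γ ∧
  ∀ ⦃v u w v' u' w' : V⦄, Is2Geodesic Γ v u w → Is2Geodesic Γ v' u' w' →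
    ∃ φ : Γ ≃g Γ, φ v = v' ∧ φ u = u' ∧ φ w = w'

open Polynomial in
/-- The coefficients of `∑ u ∈ U, f (X + u) - |U| f` in terms of the power sums of `U`. -/
theorem coeff_sum_taylor_sub {R : Type*} [CommRing R] (U : Finset R) (f : R[X]) (n : ℕ) :
    (∑ u ∈ U, taylor u f - (U.card : R[X]) * f).coeff n =
      ∑ i ∈ Finset.Ico 1 (f.natDegree + 1),
        ((n + i).choose n : R) * f.coeff (n + i) * ∑ u ∈ U, u ^ i := by
  have key : ∀ u : R, (taylor u f).coeff n =
      ∑ i ∈ Finset.range (f.natDegree + 1), ((n + i).choose n : R) * f.coeff (n + i) * u ^ i := by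
    intro u
    rw [taylor_coeff, eval_eq_sum_range' (n := f.natDegree + 1)]
    · refine Finset.sum_congr rfl fun i _ => ?_
      rw [hasseDeriv_coeff, add_comm i n]
    · exact lt_of_le_of_lt (natDegree_hasseDeriv_le f n) (by omega)
  rw [coeff_sub, finsetSum_coeff, Finset.sum_congr rfl fun u _ => key u, Finset.sum_comm,
    Finset.range_eq_Ico, Finset.sum_eq_sum_Ico_succ_bot (by omega)]
  have : ((U.card : R[X]) * f).coeff n = U.card * f.coeff n := by
    rw [← C_eq_natCast, coeff_C_mul]
  simp [this, Finset.mul_sum]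

open Polynomial in
theorem sum_eval_add_eq_of_natDegree_lt {R : Type*} [CommRing R] (U : Finset R) {m : ℕ}
    (hm : ∀ i, 1 ≤ i → i < m → ∑ u ∈ U, u ^ i = 0) (f : R[X]) (hf : f.natDegree < m) (x : R) :
    ∑ u ∈ U, f.eval (x + u) = U.card * f.eval x := by
  have h : ∑ u ∈ U, taylor u f - (U.card : R[X]) * f = 0 := by
    ext n
    rw [coeff_sum_taylor_sub, coeff_zero]
    refine Finset.sum_eq_zero fun i hi => ?_
    rw [Finset.mem_Ico] at hi
    rw [hm i hi.1 (by omega), mul_zero]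
  have h2 := congrArg (eval x) h
  simpa [eval_finsetSum, taylor_eval, sub_eq_zero, add_comm] using h2

open Polynomial in
theorem coeff_sum_taylor_sub_ne_zero {p : ℕ} [Fact p.Prime] (U : Finset (ZMod p)) {m : ℕ}
    (hm1 : 1 ≤ m) (hm : ∀ i, 1 ≤ i → i < m → ∑ u ∈ U, u ^ i = 0) (hm0 : ∑ u ∈ U, u ^ m ≠ 0)
    (f : (ZMod p)[X]) (hf : m ≤ f.natDegree) (hfp : f.natDegree < p) :
    (∑ u ∈ U, taylor u f - (U.card : (ZMod p)[X]) * f).coeff (f.natDegree - m) ≠ 0 := by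
  rw [coeff_sum_taylor_sub, Finset.sum_eq_single m]
  · rw [Nat.sub_add_cancel hf]
    refine mul_ne_zero (mul_ne_zero ?_ ?_) hm0
    · rw [Ne, ZMod.natCast_eq_zero_iff]
      intro hd
      have := (Fact.out : p.Prime).dvd_factorial.1
        (hd.trans ⟨_, by rw [← mul_assoc]; exact (Nat.choose_mul_factorial_mul_factorial (Nat.sub_le _ m)).symm⟩)
      omega
    · rw [coeff_natDegree, leadingCoeff_ne_zero]
      rintro rfl
      simp at hf
      omega
  · intro i hi him
    rw [Finset.mem_Ico] at hi
    rcases lt_or_gt_of_ne him with h | h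
    · rw [hm i hi.1 h, mul_zero]
    · rw [coeff_eq_zero_of_natDegree_lt (by omega)]
      ring
  · intro h
    exact absurd (Finset.mem_Ico.2 ⟨hm1, by omega⟩) h

open Polynomial in
theorem natDegree_sum_taylor_sub_le {R : Type*} [CommRing R] (U : Finset R) (f : R[X]) :
    (∑ u ∈ U, taylor u f - (U.card : R[X]) * f).natDegree ≤ f.natDegree := by
  refine (natDegree_sub_le _ _).trans (max_le ?_ ?_)
  · exact natDegree_sum_le_of_forall_le _ _ fun u _ => (natDegree_taylor f u).le
  · refine natDegree_mul_le.trans ?_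
    simp

open Polynomial in
theorem eq_zero_of_forall_eval_eq_zero {p : ℕ} [Fact p.Prime] (f : (ZMod p)[X])
    (hf : f.natDegree < p) (h : ∀ x, f.eval x = 0) : f = 0 := by
  refine eq_zero_of_natDegree_lt_card_of_eval_eq_zero f Function.injective_id h ?_
  simpa [ZMod.card] using hf

open Polynomial in
/-- Some power sum of small exponent of a finite set of nonzero elements does not vanish. -/
theorem exists_sum_pow_ne_zero {F : Type*} [Field F] (U : Finset F) (h0 : (0 : F) ∉ U)
    (hne : U.Nonempty) : ∃ m, 1 ≤ m ∧ m ≤ U.card ∧ ∑ u ∈ U, u ^ m ≠ 0 := by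
  classical
  by_contra! hcon
  obtain ⟨a, ha⟩ := hne
  let g : F[X] := X * ∏ b ∈ U.erase a, (X - C b)
  have hgd : g.natDegree < U.card + 1 := by
    refine lt_of_le_of_lt natDegree_mul_le ?_
    rw [natDegree_prod_of_monic _ _ fun b _ => monic_X_sub_C b]
    simp [Finset.card_erase_of_mem ha]
    have := Finset.card_pos.2 ⟨a, ha⟩
    omega
  have h1 : ∑ u ∈ U, g.eval u = 0 := by
    have : ∀ u, g.eval u = ∑ i ∈ Finset.range (U.card + 1), g.coeff i * u ^ i := fun u =>
      eval_eq_sum_range' hgd u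
    rw [Finset.sum_congr rfl fun u _ => this u, Finset.sum_comm]
    refine Finset.sum_eq_zero fun i hi => ?_
    rw [← Finset.mul_sum]
    rcases Nat.eq_zero_or_pos i with rfl | hi0
    · simp [g]
    · rw [hcon i hi0 (by simpa [Nat.lt_succ_iff] using hi), mul_zero]
  rw [Finset.sum_eq_single a] at h1
  · simp only [g, eval_mul, eval_X, eval_prod, eval_sub, eval_C, mul_eq_zero,
      Finset.prod_eq_zero_iff, Finset.mem_erase, sub_eq_zero] at h1
    rcases h1 with h | ⟨b, hb, hab⟩
    · exact h0 (h ▸ ha)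
    · exact hb.1 hab.symm
  · intro b hb hba
    simp only [g, eval_mul, eval_X, eval_prod, eval_sub, eval_C]
    rw [Finset.prod_eq_zero (Finset.mem_erase.2 ⟨hba, hb⟩) (sub_self b), mul_zero]
  · exact fun h => absurd ha h

open Polynomial in
/-- A permutation of `ZMod p` preserving the relation `y - x ∈ U`, for a small nonempty set `U` of
nonzero elements, is affine. -/
theorem affine_of_preserves_differences {p : ℕ} [Fact p.Prime] (U : Finset (ZMod p))
    (h0 : (0 : ZMod p) ∉ U) (hne : U.Nonempty) (hcard : 2 * U.card ≤ p - 1)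
    (σ : Equiv.Perm (ZMod p)) (hσ : ∀ x y, y - x ∈ U → σ y - σ x ∈ U) :
    ∃ a b, ∀ x, σ x = a * x + b := by
  classical
  have hp : p.Prime := Fact.out
  have hp2 := hp.two_le
  have hex := exists_sum_pow_ne_zero U h0 hne
  let m := Nat.find hex
  obtain ⟨hm1, hmU, hm0⟩ : 1 ≤ m ∧ m ≤ U.card ∧ ∑ u ∈ U, u ^ m ≠ 0 := Nat.find_spec hex
  have hm : ∀ i, 1 ≤ i → i < m → ∑ u ∈ U, u ^ i = 0 := by
    intro i hi him
    by_contra h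
    exact Nat.find_min hex him ⟨hi, by omega, h⟩
  have hterm : ∀ (g : ZMod p → ZMod p) (x : ZMod p),
      ∑ u ∈ U, g (σ (x + u)) = ∑ u ∈ U, g (σ x + u) := by
    intro g x
    have hmaps : Set.MapsTo (fun u => σ (x + u) - σ x) (U : Set (ZMod p)) U := by
      intro u hu
      exact hσ x (x + u) (by simpa using hu)
    have hinj : Set.InjOn (fun u => σ (x + u) - σ x) (U : Set (ZMod p)) := by
      intro u _ v _ huv
      simpa using huv
    refine Finset.sum_nbij (fun u => σ (x + u) - σ x) hmaps hinj
      (Finset.surjOn_of_injOn_of_card_le _ hmaps hinj le_rfl) ?_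
    intro u _
    simp
  let P : (ZMod p)[X] := Lagrange.interpolate Finset.univ id σ
  have hPe : ∀ x, P.eval x = σ x := fun x =>
    Lagrange.eval_interpolate_at_node σ (Function.injective_id.injOn) (Finset.mem_univ x)
  have hPd : P.natDegree < p := by
    have h := Lagrange.degree_interpolate_lt (s := Finset.univ) (v := id) σ
      (Function.injective_id.injOn)
    rw [Finset.card_univ, ZMod.card] at h
    by_cases hP : P = 0
    · rw [hP]; simpa using hp.pos
    · exact (natDegree_lt_iff_degree_lt hP).2 h
  rcases Nat.lt_or_ge P.natDegree 2 with hn | hn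
  · refine ⟨P.coeff 1, P.coeff 0, fun x => ?_⟩
    rw [← hPe x, eval_eq_sum_range' hn]
    simp [Finset.sum_range_succ, add_comm]
  exfalso
  have hA : ∀ f : (ZMod p)[X], ∀ x,
      (∑ u ∈ U, taylor u f - (U.card : (ZMod p)[X]) * f).eval x =
        ∑ u ∈ U, f.eval (x + u) - U.card * f.eval x := by
    intro f x
    simp [eval_finsetSum, taylor_eval]
  have hpow : ∀ j, j < m → P.natDegree * j < p → P.natDegree * j < m := by
    intro j hj hjp
    by_contra! hcon
    have hdeg : (P ^ j).natDegree = P.natDegree * j := by rw [natDegree_pow, mul_comm]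
    refine coeff_sum_taylor_sub_ne_zero U hm1 hm hm0 (P ^ j) (by omega) (by omega) ?_
    rw [eq_zero_of_forall_eval_eq_zero (∑ u ∈ U, taylor u (P ^ j) - (U.card : (ZMod p)[X]) * P ^ j),
      coeff_zero]
    · exact lt_of_le_of_lt (natDegree_sum_taylor_sub_le _ _) (by omega)
    · intro x
      have h1 := sum_eval_add_eq_of_natDegree_lt U hm (X ^ j) (by simpa using hj) (σ x)
      simp only [eval_pow, eval_X] at h1
      rw [hA]
      simp only [eval_pow, hPe]
      rw [hterm (fun z => z ^ j), h1, sub_self]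
  rcases Nat.lt_or_ge m 2 with hm2 | hm2
  · have hm1' : m = 1 := by omega
    have hc := coeff_sum_taylor_sub_ne_zero U hm1 hm hm0 P (by omega) hPd
    refine hc ?_
    have h2 : ∑ u ∈ U, taylor u P - (U.card : (ZMod p)[X]) * P - C (∑ u ∈ U, u) = 0 := by
      apply eq_zero_of_forall_eval_eq_zero
      · refine lt_of_le_of_lt (natDegree_sub_le _ _) (max_lt ?_ ?_)
        · exact lt_of_le_of_lt (natDegree_sum_taylor_sub_le _ _) hPd
        · rw [natDegree_C]
          exact hp.pos
      · intro x
        rw [eval_sub, hA, eval_C]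
        simp only [hPe]
        rw [hterm (fun z => z)]
        rw [Finset.sum_add_distrib, Finset.sum_const, nsmul_eq_mul, add_sub_cancel_left, sub_self]
    rw [sub_eq_zero.1 h2, coeff_C_of_ne_zero (by omega)]
  · have hn1 : P.natDegree < m := by simpa using hpow 1 (by omega) (by simpa using hPd)
    have hdm := Nat.div_add_mod (m - 1) P.natDegree
    have hml := Nat.mod_lt (m - 1) (show 0 < P.natDegree by omega)
    have h2 : 2 * ((m - 1) / P.natDegree) ≤ P.natDegree * ((m - 1) / P.natDegree) :=
      Nat.mul_le_mul_right _ hn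
    have := hpow ((m - 1) / P.natDegree + 1) (by omega) (by rw [mul_add, mul_one]; omega)
    rw [mul_add, mul_one] at this
    omega

/-- A transitive permutation group of prime degree `p` contains, in suitable coordinates, the
translations of `ZMod p`. -/
theorem exists_equiv_zmod_of_transitive {p : ℕ} [Fact p.Prime] {X : Type*} [Finite X]
    (hX : Nat.card X = p) (L : Subgroup (Equiv.Perm X)) (hL : ∀ x y, ∃ g ∈ L, g x = y) :
    ∃ e : ZMod p ≃ X, ∀ t, ∃ g ∈ L, ∀ x, g (e x) = e (x + t) := by
  classical
  have hp : p.Prime := Fact.out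
  have : Fintype X := Fintype.ofFinite X
  have hne : Nonempty X := (Nat.card_pos_iff.1 (hX ▸ hp.pos)).1
  obtain ⟨x₀⟩ := hne
  have htr : MulAction.IsPretransitive L X :=
    ⟨fun x y => by obtain ⟨g, hg, h⟩ := hL x y; exact ⟨⟨g, hg⟩, h⟩⟩
  have hdvd : p ∣ Nat.card L := by
    rw [← hX, ← MulAction.index_stabilizer_of_transitive L x₀]
    exact Subgroup.index_dvd_card _
  obtain ⟨g, hg⟩ := exists_prime_orderOf_dvd_card' p hdvd
  have hgo : orderOf (g : Equiv.Perm X) = p := by rw [Subgroup.orderOf_coe, hg]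
  obtain ⟨x, hx⟩ : ∃ x, (g : Equiv.Perm X) x ≠ x := by
    by_contra! h
    have : (g : Equiv.Perm X) = 1 := Equiv.ext h
    rw [this, orderOf_one] at hgo
    exact hp.one_lt.ne hgo
  have hpow : (g : Equiv.Perm X) ^ p = 1 := by rw [← hgo, pow_orderOf_eq_one]
  have hfix : ∀ n : ℕ, ((g : Equiv.Perm X) ^ n) x = x ↔ p ∣ n := by
    intro n
    have hper : Function.minimalPeriod (g : Equiv.Perm X) x = p := by
      have h1 : Function.minimalPeriod (g : Equiv.Perm X) x ∣ p := by
        rw [← Function.isPeriodicPt_iff_minimalPeriod_dvd, Function.IsPeriodicPt,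
          Function.IsFixedPt, ← Equiv.Perm.coe_pow, hpow]
        rfl
      rcases (Nat.dvd_prime hp).1 h1 with h | h
      · rw [Function.minimalPeriod_eq_one_iff_isFixedPt] at h
        exact absurd h hx
      · exact h
    rw [← hper, ← Function.isPeriodicPt_iff_minimalPeriod_dvd, Function.IsPeriodicPt,
      Function.IsFixedPt, ← Equiv.Perm.coe_pow]
  have hmod : ∀ m n : ℕ, ((m : ZMod p) = n) →
      ((g : Equiv.Perm X) ^ m) = ((g : Equiv.Perm X) ^ n) := by
    intro m n h
    rw [ZMod.natCast_eq_natCast_iff] at h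
    rwa [pow_eq_pow_iff_modEq, hgo]
  let f : ZMod p → X := fun a => ((g : Equiv.Perm X) ^ a.val) x
  have hf : Function.Injective f := by
    intro a b hab
    wlog hle : a.val ≤ b.val generalizing a b
    · exact (this hab.symm (by omega)).symm
    have h1 : ((g : Equiv.Perm X) ^ (b.val - a.val)) x = x := by
      apply ((g : Equiv.Perm X) ^ a.val).injective
      rw [← Equiv.Perm.mul_apply, ← pow_add, Nat.add_sub_cancel' hle]
      exact hab.symm
    rw [hfix] at h1
    have := Nat.eq_zero_of_dvd_of_lt h1 (by have := ZMod.val_lt b; omega)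
    exact ZMod.val_injective p (by omega)
  have hbij : Function.Bijective f :=
    (Fintype.bijective_iff_injective_and_card f).2
      ⟨hf, by rw [ZMod.card, ← Nat.card_eq_fintype_card, hX]⟩
  refine ⟨Equiv.ofBijective f hbij, fun t => ⟨(g : Equiv.Perm X) ^ t.val, L.pow_mem g.2 _, ?_⟩⟩
  intro a
  change ((g : Equiv.Perm X) ^ t.val) (((g : Equiv.Perm X) ^ a.val) x) =
    ((g : Equiv.Perm X) ^ (a + t).val) x
  rw [← Equiv.Perm.mul_apply, ← pow_add]
  congr 1
  apply hmod
  simp [add_comm]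

/-- Burnside's theorem on permutation groups of prime degree: a transitive group preserving a
binary relation that is neither empty nor complete off the diagonal is affine. -/
theorem exists_affine_coordinates {p : ℕ} [Fact p.Prime] {X : Type*} [Finite X]
    (hX : Nat.card X = p) (L : Subgroup (Equiv.Perm X)) (hL : ∀ x y, ∃ g ∈ L, g x = y)
    (R : X → X → Prop) (hR : ∀ g ∈ L, ∀ x y, R (g x) (g y) ↔ R x y)
    (hR1 : ∃ x y, x ≠ y ∧ R x y) (hR2 : ∃ x y, x ≠ y ∧ ¬ R x y) :
    ∃ e : ZMod p ≃ X, (∀ t, ∃ g ∈ L, ∀ x, g (e x) = e (x + t)) ∧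
      ∀ g ∈ L, ∃ a b, ∀ x, g (e x) = e (a * x + b) := by
  classical
  have hp : p.Prime := Fact.out
  obtain ⟨e, he⟩ := exists_equiv_zmod_of_transitive hX L hL
  refine ⟨e, he, fun g hg => ?_⟩
  have hdiff : ∀ x y, R (e x) (e y) ↔ R (e 0) (e (y - x)) := by
    intro x y
    obtain ⟨h, hhL, hh⟩ := he (-x)
    rw [← hR h hhL, hh, hh, add_neg_cancel, sub_eq_add_neg]
  let U (Q : Prop → Prop) : Finset (ZMod p) := {d | d ≠ 0 ∧ Q (R (e 0) (e d))}
  have hU : ∀ Q : Prop → Prop, (∃ x y, x ≠ y ∧ Q (R x y)) → 2 * (U Q).card ≤ p - 1 →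
      ∃ a b, ∀ x, g (e x) = e (a * x + b) := by
    intro Q ⟨x, y, hxy, hQ⟩ hc
    have hmem : ∀ x y, y - x ∈ U Q ↔ x ≠ y ∧ Q (R (e x) (e y)) := by
      intro x y
      simp only [U, Finset.mem_filter, Finset.mem_univ, true_and, ← hdiff, sub_ne_zero]
      rw [ne_comm]
    obtain ⟨a, b, hab⟩ := affine_of_preserves_differences (U Q) (by simp [U])
      ⟨e.symm y - e.symm x, by rw [hmem]; simpa using ⟨hxy, hQ⟩⟩ hc ((e.trans g).trans e.symm) (by
        intro x y
        rw [hmem, hmem]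
        simp [hR g hg])
    refine ⟨a, b, fun x => ?_⟩
    rw [← hab]
    simp
  have hsum : (U id).card + (U Not).card = p - 1 := by
    rw [← Finset.card_union_of_disjoint]
    · have : U id ∪ U Not = Finset.univ.erase 0 := by
        ext d
        simp only [U, Finset.mem_union, Finset.mem_filter, Finset.mem_univ, true_and, id,
          Finset.mem_erase]
        tauto
      rw [this, Finset.card_erase_of_mem (Finset.mem_univ _), Finset.card_univ, ZMod.card]
    · rw [Finset.disjoint_left]
      intro d h1 h2
      simp only [U, Finset.mem_filter, Finset.mem_univ, true_and, id] at h1 h2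
      exact h2.2 h1.2
  rcases le_total (U id).card (U Not).card with h | h
  · exact hU id hR1 (by omega)
  · exact hU Not hR2 (by omega)

theorem isSquare_mul_iff {F : Type*} [Field F] [Finite F] {x y : F} (hx : x ≠ 0) (hy : y ≠ 0) :
    IsSquare (x * y) ↔ (IsSquare x ↔ IsSquare y) := by
  classical
  have : Fintype F := Fintype.ofFinite F
  rw [← quadraticChar_one_iff_isSquare (mul_ne_zero hx hy), ← quadraticChar_one_iff_isSquare hx,
    ← quadraticChar_one_iff_isSquare hy, map_mul]
  rcases quadraticChar_dichotomy hx with h | h <;> rcases quadraticChar_dichotomy hy with h' | h' <;>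
    simp [h, h']

theorem exists_not_isSquare_zmod {p : ℕ} [Fact p.Prime] (h2 : p ≠ 2) :
    ∃ n : ZMod p, n ≠ 0 ∧ ¬ IsSquare n := by
  obtain ⟨n, hn⟩ := FiniteField.exists_nonsquare (F := ZMod p) (by rwa [ZMod.ringChar_zmod_n])
  exact ⟨n, by rintro rfl; exact hn (.zero), hn⟩

theorem isSquare_neg_iff_of_mod_four {p : ℕ} [Fact p.Prime] (h4 : p % 4 = 1) (x : ZMod p) :
    IsSquare (-x) ↔ IsSquare x := by
  rcases eq_or_ne x 0 with rfl | hx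
  · simp
  have h1 : IsSquare (-1 : ZMod p) := ZMod.exists_sq_eq_neg_one_iff.2 (by omega)
  rw [← neg_one_mul, isSquare_mul_iff (by simp) hx]
  simp [h1]

theorem card_filter_eq_of_equiv {α β : Type*} [Fintype α] [Fintype β] {P : α → Prop} {Q : β → Prop}
    [DecidablePred P] [DecidablePred Q] (φ : α ≃ β) (h : ∀ x, P x ↔ Q (φ x)) :
    ({x | P x} : Finset α).card = ({x | Q x} : Finset β).card :=
  Finset.card_equiv φ (by simpa using h)

/-- The number of common neighbours of two nonadjacent vertices of a Paley graph. -/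
theorem four_mul_card_nonsquare_pairs {p : ℕ} [Fact p.Prime] [DecidablePred (IsSquare (α := ZMod p))]
    (h4 : p % 4 = 1) :
    4 * ({t | ¬ IsSquare t ∧ ¬ IsSquare (t - 1)} : Finset (ZMod p)).card = p - 1 ∧
    ({t | ¬ IsSquare t ∧ ¬ IsSquare (t - 1)} : Finset (ZMod p)).card =
      ({t | ¬ IsSquare t ∧ IsSquare (t - 1)} : Finset (ZMod p)).card := by
  have hA : ({t | ¬ IsSquare t ∧ ¬ IsSquare (t - 1)} : Finset (ZMod p)).card =
      ({t | ¬ IsSquare t ∧ IsSquare (t - 1)} : Finset (ZMod p)).card := by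
    refine card_filter_eq_of_equiv (Equiv.inv (ZMod p)) fun t => ?_
    rw [Equiv.inv_apply, isSquare_inv]
    refine and_congr_right fun ht => ?_
    have ht0 : t ≠ 0 := by rintro rfl; exact ht .zero
    have ht1 : t - 1 ≠ 0 := by
      intro h; rw [sub_eq_zero.1 h] at ht; exact ht .one
    have : t⁻¹ - 1 = -(t⁻¹ * (t - 1)) := by field_simp; ring
    rw [this, isSquare_neg_iff_of_mod_four h4, isSquare_mul_iff (inv_ne_zero ht0) ht1, isSquare_inv]
    tauto
  refine ⟨?_, hA⟩
  obtain ⟨n, hn0, hn⟩ := exists_not_isSquare_zmod (p := p) (by rintro rfl; simp at h4)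
  have h1 : ({t | ¬ IsSquare t} : Finset (ZMod p)).card =
      ({t | ¬ IsSquare t ∧ ¬ IsSquare (t - 1)} : Finset (ZMod p)).card +
      ({t | ¬ IsSquare t ∧ IsSquare (t - 1)} : Finset (ZMod p)).card := by
    rw [add_comm, ← Finset.filter_filter, ← Finset.filter_filter, Finset.card_filter_add_card_filter_not]
  have h2 : ({t | ¬ IsSquare t} : Finset (ZMod p)).card =
      ({t | t ≠ 0 ∧ IsSquare t} : Finset (ZMod p)).card := by
    refine card_filter_eq_of_equiv (Equiv.mulLeft₀ n hn0) fun t => ?_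
    rcases eq_or_ne t 0 with rfl | ht
    · simp
    · simp [isSquare_mul_iff hn0 ht, hn, hn0, ht]
  have h3 : ({t | t ≠ 0 ∧ IsSquare t} : Finset (ZMod p)).card +
      ({t | ¬ IsSquare t} : Finset (ZMod p)).card = p - 1 := by
    have : ({t | ¬ IsSquare t} : Finset (ZMod p)) = ({t | t ≠ 0 ∧ ¬ IsSquare t} : Finset (ZMod p)) := by
      ext t
      simp only [Finset.mem_filter, Finset.mem_univ, true_and]
      constructor
      · exact fun h => ⟨by rintro rfl; exact h .zero, h⟩
      · exact fun h => h.2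
    rw [this, ← Finset.filter_filter, ← Finset.filter_filter, Finset.card_filter_add_card_filter_not,
      Finset.filter_ne', Finset.card_erase_of_mem (Finset.mem_univ _), Finset.card_univ, ZMod.card]
  omega

/-- Adjacent vertices of a Paley graph are not twins. -/
theorem exists_isSquare_sub_and_not {p : ℕ} [Fact p.Prime] (h4 : p % 4 = 1) {a b : ZMod p}
    (hab : a ≠ b) (hs : IsSquare (a - b)) :
    ∃ x, x ≠ a ∧ x ≠ b ∧ IsSquare (x - a) ∧ ¬ IsSquare (x - b) := by
  classical
  obtain ⟨h1, h2⟩ := four_mul_card_nonsquare_pairs h4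
  have hp := (Fact.out : p.Prime).two_le
  obtain ⟨t, ht⟩ := Finset.card_pos.1 (show
    0 < ({t | ¬ IsSquare t ∧ IsSquare (t - 1)} : Finset (ZMod p)).card by omega)
  simp only [Finset.mem_filter, Finset.mem_univ, true_and] at ht
  have ht0 : t ≠ 0 := by rintro rfl; exact ht.1 .zero
  have ht1 : t - 1 ≠ 0 := by
    intro h; rw [sub_eq_zero.1 h] at ht; exact ht.1 .one
  have hab' := sub_ne_zero.2 hab
  have e1 : b + t * (a - b) - a = (t - 1) * (a - b) := by ring
  have e2 : b + t * (a - b) - b = t * (a - b) := by ring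
  refine ⟨b + t * (a - b), ?_, ?_, ?_, ?_⟩
  · rw [← sub_ne_zero, e1]; exact mul_ne_zero ht1 hab'
  · rw [← sub_ne_zero, e2]; exact mul_ne_zero ht0 hab'
  · rw [e1]; exact ht.2.mul hs
  · rw [e2, isSquare_mul_iff ht0 hab']
    tauto

section OrbitOfUnits

variable {p : ℕ} [Fact p.Prime] (H : Subgroup (ZMod p)ˣ) (S : Finset (ZMod p))
  (h0 : (0 : ZMod p) ∉ S) (hmul : ∀ a ∈ H, ∀ d ∈ S, (a : ZMod p) * d ∈ S)
  (htr : ∀ d ∈ S, ∀ d' ∈ S, ∃ a ∈ H, (a : ZMod p) * d = d') (hne : S.Nonempty)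

include h0 hmul htr hne

theorem card_eq_card_of_unit_orbit : Nat.card H = S.card := by
  obtain ⟨s, hs⟩ := hne
  have hs0 : s ≠ 0 := fun h => h0 (h ▸ hs)
  rw [← Nat.card_eq_finsetCard S]
  refine Nat.card_congr (Equiv.ofBijective
    (fun a : H => (⟨(a : (ZMod p)ˣ) * s, hmul _ a.2 s hs⟩ : S)) ⟨?_, ?_⟩)
  · intro a b hab
    simp only [Subtype.mk.injEq] at hab
    exact Subtype.ext (Units.ext (mul_right_cancel₀ hs0 hab))
  · rintro ⟨d, hd⟩
    obtain ⟨a, ha, had⟩ := htr s hs d hd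
    exact ⟨⟨a, ha⟩, Subtype.ext had⟩

theorem card_dvd_sub_one_of_unit_orbit : S.card ∣ p - 1 := by
  rw [← card_eq_card_of_unit_orbit H S h0 hmul htr hne, ← ZMod.card_units p,
    ← Nat.card_eq_fintype_card]
  exact Subgroup.card_subgroup_dvd_card H

theorem isSquare_of_mem_of_card (hcard : 2 * S.card + 1 = p) (a : (ZMod p)ˣ) :
    a ∈ H ↔ IsSquare (a : ZMod p) := by
  have hH := card_eq_card_of_unit_orbit H S h0 hmul htr hne
  have hS := hne.card_pos
  have hU : Nat.card (ZMod p)ˣ = p - 1 := by rw [Nat.card_eq_fintype_card, ZMod.card_units]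
  have hidx : H.index = 2 := by
    have := H.card_mul_index
    rw [hH, hU] at this
    have h2 : S.card * H.index = S.card * 2 := by omega
    exact Nat.eq_of_mul_eq_mul_left hS h2
  have hsq : ∀ b : (ZMod p)ˣ, IsSquare (b : ZMod p) → b ∈ H := by
    rintro b ⟨c, hc⟩
    have hc0 : c ≠ 0 := by rintro rfl; simp at hc
    have : b = (Units.mk0 c hc0) ^ 2 := Units.ext (by simp [hc, sq])
    rw [this]
    exact Subgroup.sq_mem_of_index_two hidx _
  refine ⟨fun ha => ?_, hsq a⟩
  by_contra hns
  have : H = ⊤ := by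
    rw [eq_top_iff]
    intro b _
    by_cases hb : IsSquare (b : ZMod p)
    · exact hsq b hb
    · rw [← mul_inv_cancel_right b a, mul_comm b a]
      rw [mul_inv_cancel_comm]
      have h1 : b * a ∈ H := hsq _ (by
        rw [Units.val_mul, isSquare_mul_iff b.ne_zero a.ne_zero]; tauto)
      simpa using H.mul_mem h1 (H.inv_mem ha)
  rw [this, Subgroup.index_top] at hidx
  omega

theorem exists_mem_iff_not_isSquare_of_card (hcard : 2 * S.card + 1 = p) :
    ∃ c : ZMod p, c ≠ 0 ∧ ∀ d, d ≠ 0 → (d ∈ S ↔ ¬ IsSquare (c * d)) := by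
  have hH := isSquare_of_mem_of_card H S h0 hmul htr hne hcard
  obtain ⟨s, hs⟩ := hne
  have hs0 : s ≠ 0 := fun h => h0 (h ▸ hs)
  obtain ⟨n, hn0, hn⟩ := exists_not_isSquare_zmod (p := p) (by omega)
  refine ⟨n * s, mul_ne_zero hn0 hs0, fun d hd => ?_⟩
  have h1 : d ∈ S ↔ IsSquare (s * d) := by
    constructor
    · intro h
      obtain ⟨a, ha, had⟩ := htr s hs d h
      obtain ⟨c, hc⟩ := (hH a).1 ha
      exact ⟨c * s, by rw [← had, hc]; ring⟩
    · rintro ⟨c, hc⟩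
      have hds : d * s⁻¹ ≠ 0 := mul_ne_zero hd (inv_ne_zero hs0)
      have := hmul (Units.mk0 (d * s⁻¹) hds) ((hH _).2 ⟨c * s⁻¹, by
        rw [Units.val_mk0]; field_simp; rw [← hc.trans (sq c).symm]; ring⟩) s hs
      rw [Units.val_mk0] at this
      rwa [inv_mul_cancel_right₀ hs0] at this
  rw [h1, mul_assoc, isSquare_mul_iff hn0 (mul_ne_zero hs0 hd)]
  tauto

theorem mod_four_eq_one_of_card (hcard : 2 * S.card + 1 = p) (hneg : ∀ d ∈ S, -d ∈ S) :
    p % 4 = 1 := by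
  have hH := isSquare_of_mem_of_card H S h0 hmul htr hne hcard
  obtain ⟨s, hs⟩ := hne
  have hs0 : s ≠ 0 := fun h => h0 (h ▸ hs)
  obtain ⟨a, ha, has⟩ := htr s hs (-s) (hneg s hs)
  have h1 : (a : ZMod p) = -1 := mul_right_cancel₀ hs0 (by rw [has, neg_one_mul])
  have h2 := (hH a).1 ha
  rw [h1, ZMod.exists_sq_eq_neg_one_iff] at h2
  omega

end OrbitOfUnits

theorem connected_induction {V : Type*} {Γ : SimpleGraph V} (h : Γ.Connected) (P : V → Prop)
    {x : V} (hx : P x) (hP : ∀ a b, P a → Γ.Adj a b → P b) (y : V) : P y := by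
  obtain ⟨w⟩ := h.preconnected x y
  induction w with
  | nil => exact hx
  | cons hab _ ih => exact ih (hP _ _ hx hab)

theorem exists_is2Geodesic {V : Type*} {Γ : SimpleGraph V} (h : Γ.Connected) (hnc : Γ ≠ ⊤) :
    ∃ v u w, Is2Geodesic Γ v u w := by
  by_contra! hcon
  refine hnc (eq_top_iff.2 fun x y hxy => ?_)
  refine (connected_induction h (fun y => x = y ∨ Γ.Adj x y) (Or.inl rfl) ?_ y).resolve_left hxy
  rintro a b (rfl | ha) hab
  · exact Or.inr hab
  · by_contra! hb
    exact hcon x a b ⟨ha, hab, hb.1, hb.2⟩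

theorem exists_triangle {V : Type*} {Γ : SimpleGraph V} (h : TwoGeodesicTransitive Γ)
    (h2 : ¬ TwoArcTransitive Γ) : ∃ v u w, Γ.Adj v u ∧ Γ.Adj u w ∧ v ≠ w ∧ Γ.Adj v w := by
  by_contra! hcon
  refine h2 ⟨h.1, fun v u w v' u' w' ha ha' => h.2 ⟨ha.1, ha.2.1, ha.2.2, ?_⟩ ⟨ha'.1, ha'.2.1, ha'.2.2, ?_⟩⟩
  · exact hcon v u w ha.1 ha.2.1 ha.2.2
  · exact hcon v' u' w' ha'.1 ha'.2.1 ha'.2.2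

/-- Coordinates on the neighbourhood of `u` in which the stabilizer of `u` acts affinely and
induces all translations. -/
structure IsLocalCoordinate {V : Type*} (Γ : SimpleGraph V) {p : ℕ} (u : V)
    (e : ZMod p ≃ Γ.neighborSet u) : Prop where
  translation : ∀ t, ∃ φ : Γ ≃g Γ, φ u = u ∧ ∀ x, φ (e x) = (e (x + t) : V)
  affine : ∀ φ : Γ ≃g Γ, φ u = u → ∃ a b, ∀ x, φ (e x) = (e (a * x + b) : V)

/-- The permutation group induced on the neighbourhood of a vertex by its stabilizer. -/
def localGroup {V : Type*} (Γ : SimpleGraph V) (u : V) :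
    Subgroup (Equiv.Perm (Γ.neighborSet u)) where
  carrier := {σ | ∃ φ : Γ ≃g Γ, φ u = u ∧ ∀ x : Γ.neighborSet u, φ x = (σ x : V)}
  mul_mem' := by
    rintro σ τ ⟨φ, hφ, h⟩ ⟨ψ, hψ, h'⟩
    exact ⟨ψ.trans φ, by simp [hφ, hψ], fun x => by simp [h', h]⟩
  one_mem' := ⟨RelIso.refl _, rfl, fun _ => rfl⟩
  inv_mem' := by
    rintro σ ⟨φ, hφ, h⟩
    refine ⟨φ.symm, by rw [RelIso.symm_apply_eq, hφ], fun x => ?_⟩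
    rw [RelIso.symm_apply_eq, h, ← Equiv.Perm.mul_apply, mul_inv_cancel, Equiv.Perm.one_apply]

/-- The permutation of the neighbourhood of a fixed vertex induced by an automorphism. -/
def localPerm {V : Type*} {Γ : SimpleGraph V} {u : V} (φ : Γ ≃g Γ) (hφ : φ u = u) :
    Equiv.Perm (Γ.neighborSet u) where
  toFun x := ⟨φ x, by rw [mem_neighborSet]; nth_rw 1 [← hφ]; exact φ.map_adj_iff.2 x.2⟩
  invFun x := ⟨φ.symm x, by
    rw [mem_neighborSet, ← φ.map_adj_iff, hφ, RelIso.apply_symm_apply]; exact x.2⟩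
  left_inv x := by simp
  right_inv x := by simp

theorem localPerm_mem {V : Type*} {Γ : SimpleGraph V} {u : V} (φ : Γ ≃g Γ) (hφ : φ u = u) :
    localPerm φ hφ ∈ localGroup Γ u :=
  ⟨φ, hφ, fun _ => rfl⟩

theorem exists_isLocalCoordinate {V : Type*} [Finite V] {Γ : SimpleGraph V} {p : ℕ} [Fact p.Prime]
    {u : V} (hreg : Nat.card (Γ.neighborSet u) = p) (hat : ArcTransitive Γ)
    (hnon : ∃ v w, Γ.Adj u v ∧ Γ.Adj u w ∧ v ≠ w ∧ ¬ Γ.Adj v w)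
    (htri : ∃ v w, Γ.Adj u v ∧ Γ.Adj u w ∧ v ≠ w ∧ Γ.Adj v w) :
    ∃ e : ZMod p ≃ Γ.neighborSet u, IsLocalCoordinate Γ u e := by
  obtain ⟨e, h1, h2⟩ := exists_affine_coordinates hreg (localGroup Γ u)
    (by
      intro x y
      obtain ⟨φ, hφ, hxy⟩ := hat x.2 y.2
      exact ⟨localPerm φ hφ, localPerm_mem φ hφ, Subtype.ext hxy⟩)
    (fun x y => Γ.Adj x y)
    (by
      rintro g ⟨φ, -, h⟩ x y
      rw [← h, ← h]
      exact φ.map_adj_iff)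
    (by
      obtain ⟨v, w, hv, hw, hvw, ha⟩ := htri
      exact ⟨⟨v, hv⟩, ⟨w, hw⟩, fun h => hvw (congrArg Subtype.val h), ha⟩)
    (by
      obtain ⟨v, w, hv, hw, hvw, ha⟩ := hnon
      exact ⟨⟨v, hv⟩, ⟨w, hw⟩, fun h => hvw (congrArg Subtype.val h), ha⟩)
  refine ⟨e, fun t => ?_, fun φ hφ => ?_⟩
  · obtain ⟨g, ⟨φ, hφ, h⟩, hg⟩ := h1 t
    exact ⟨φ, hφ, fun x => by rw [h, hg]⟩
  · obtain ⟨a, b, hab⟩ := h2 _ (localPerm_mem φ hφ)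
    exact ⟨a, b, fun x => congrArg Subtype.val (hab x)⟩

namespace IsLocalCoordinate

variable {V : Type*} {Γ : SimpleGraph V} {p : ℕ} [Fact p.Prime] {u : V}
  {e : ZMod p ≃ Γ.neighborSet u}

theorem apply_eq_self (he : IsLocalCoordinate Γ u e) {φ : Γ ≃g Γ} (hu : φ u = u) {v w : V}
    (huv : Γ.Adj u v) (huw : Γ.Adj u w) (hvw : v ≠ w) (hv : φ v = v) (hw : φ w = w) (x : V)
    (hx : Γ.Adj u x) : φ x = x := by
  obtain ⟨a, b, hab⟩ := he.affine φ hu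
  have hcoord : ∀ y, Γ.Adj u y → ∃ t, (e t : V) = y := fun y hy => ⟨e.symm ⟨y, hy⟩, by simp⟩
  obtain ⟨s, rfl⟩ := hcoord v huv
  obtain ⟨t, rfl⟩ := hcoord w huw
  obtain ⟨z, rfl⟩ := hcoord x hx
  have hinj : ∀ y, φ (e y) = (e y : V) ↔ a * y + b = y := by
    intro y
    rw [hab, Subtype.val_injective.eq_iff, e.injective.eq_iff]
  rw [hinj] at hv hw ⊢
  have hst : s - t ≠ 0 := by
    rw [sub_ne_zero]
    rintro rfl
    exact hvw rfl
  have ha : a = 1 := by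
    have : (a - 1) * (s - t) = 0 := by linear_combination hv - hw
    exact sub_eq_zero.1 ((mul_eq_zero.1 this).resolve_right hst)
  subst ha
  linear_combination hv

theorem adj_iff (he : IsLocalCoordinate Γ u e) (x y : ZMod p) :
    Γ.Adj (e x) (e y) ↔ Γ.Adj (e 0) (e (y - x)) := by
  obtain ⟨φ, -, h⟩ := he.translation (-x)
  rw [← φ.map_adj_iff, h, h, add_neg_cancel, sub_eq_add_neg]

/-- The stabilizer of `u` and the neighbour `e 0` acts through a group of multiplications, which
is transitive on the neighbours of `u` that are not adjacent to `e 0`. -/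
theorem exists_unit_group (he : IsLocalCoordinate Γ u e) (h : TwoGeodesicTransitive Γ) :
    ∃ H : Subgroup (ZMod p)ˣ,
      (∀ a ∈ H, ∀ d, (d ≠ 0 ∧ ¬ Γ.Adj (e 0) (e d)) →
        (a : ZMod p) * d ≠ 0 ∧ ¬ Γ.Adj (e 0) (e (a * d))) ∧
      ∀ d, (d ≠ 0 ∧ ¬ Γ.Adj (e 0) (e d)) → ∀ d', (d' ≠ 0 ∧ ¬ Γ.Adj (e 0) (e d')) →
        ∃ a ∈ H, (a : ZMod p) * d = d' := by
  let H : Subgroup (ZMod p)ˣ :=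
    { carrier := {a | ∃ φ : Γ ≃g Γ, φ u = u ∧ ∀ x, φ (e x) = (e (a * x) : V)}
      mul_mem' := by
        rintro a b ⟨φ, hφ, h⟩ ⟨ψ, hψ, h'⟩
        exact ⟨ψ.trans φ, by simp [hφ, hψ], fun x => by simp [h', h, mul_assoc]⟩
      one_mem' := ⟨RelIso.refl _, rfl, fun _ => by simp⟩
      inv_mem' := by
        rintro a ⟨φ, hφ, h⟩
        refine ⟨φ.symm, by rw [RelIso.symm_apply_eq, hφ], fun x => ?_⟩
        rw [RelIso.symm_apply_eq, h, Units.mul_inv_cancel_left] }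
  refine ⟨H, ?_, ?_⟩
  · rintro a ⟨φ, hφ, h⟩ d ⟨hd, hd'⟩
    refine ⟨mul_ne_zero a.ne_zero hd, ?_⟩
    rwa [← h, ← (congrArg (fun z => (e z : V)) (mul_zero (a : ZMod p))), ← h, φ.map_adj_iff]
  · rintro d ⟨hd, hd'⟩ d' ⟨hd0, hd0'⟩
    have hgeo : ∀ d, d ≠ 0 → ¬ Γ.Adj (e 0) (e d) → Is2Geodesic Γ (e 0 : V) u (e d) := by
      intro d hd hd'
      exact ⟨(e 0).2.symm, (e d).2, by
        rw [Ne, Subtype.val_injective.eq_iff, e.injective.eq_iff]; exact hd.symm, hd'⟩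
    obtain ⟨φ, h1, h2, h3⟩ := h.2 (hgeo d hd hd') (hgeo d' hd0 hd0')
    obtain ⟨a, b, hab⟩ := he.affine φ h2
    rw [hab, Subtype.val_injective.eq_iff, e.injective.eq_iff] at h1 h3
    have hb : b = 0 := by simpa using h1
    subst hb
    rw [add_zero] at h3
    have ha : a ≠ 0 := by
      rintro rfl
      exact hd0 (by rw [← h3, zero_mul])
    exact ⟨Units.mk0 a ha, ⟨φ, h2, fun x => by rw [hab, add_zero, Units.val_mk0]⟩, h3⟩

end IsLocalCoordinate

/-- An automorphism fixing a vertex and two of its neighbours is trivial, if all neighbourhoods have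
affine coordinates and every edge lies in a triangle. -/
theorem eq_refl_of_apply_eq_self {V : Type*} {Γ : SimpleGraph V} {p : ℕ} [Fact p.Prime]
    (hconn : Γ.Connected) (hloc : ∀ u, ∃ e : ZMod p ≃ Γ.neighborSet u, IsLocalCoordinate Γ u e)
    (htri : ∀ u v, Γ.Adj u v → ∃ w, Γ.Adj u w ∧ Γ.Adj v w) {φ : Γ ≃g Γ} {u v w : V} (hu : φ u = u)
    (huv : Γ.Adj u v) (huw : Γ.Adj u w) (hvw : v ≠ w) (hv : φ v = v) (hw : φ w = w) (x : V) :
    φ x = x := by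
  refine (connected_induction hconn (fun y => φ y = y ∧ ∀ z, Γ.Adj y z → φ z = z) (x := u)
    ⟨hu, ?_⟩ ?_ x).1
  · obtain ⟨e, he⟩ := hloc u
    exact he.apply_eq_self hu huv huw hvw hv hw
  · rintro a b ⟨ha, hN⟩ hab
    obtain ⟨e, he⟩ := hloc b
    obtain ⟨c, hac, hbc⟩ := htri a b hab
    exact ⟨hN b hab, he.apply_eq_self (hN b hab) hab.symm hbc hac.ne ha (hN c hac)⟩

/-- `u` and `w` are at distance two. -/
def DistTwo {V : Type*} (Γ : SimpleGraph V) (u w : V) : Prop :=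
  u ≠ w ∧ ¬ Γ.Adj u w ∧ ∃ v, Γ.Adj u v ∧ Γ.Adj v w

/-- `Γ` is locally a Paley graph on `p` points, and any two vertices at distance two have
`(p - 1) / 2` common neighbours. -/
structure IsLocallyPaley {V : Type*} [Fintype V] [DecidableEq V] (Γ : SimpleGraph V)
    [DecidableRel Γ.Adj] (p r : ℕ) : Prop where
  two_mul_add_one : 2 * r + 1 = p
  mod_four : p % 4 = 1
  coordinate : ∀ u, ∃ e : ZMod p ≃ Γ.neighborSet u, ∀ x y,
    Γ.Adj (e x) (e y) ↔ x ≠ y ∧ IsSquare (x - y)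
  card_neighbors : ∀ u, ({x | Γ.Adj u x} : Finset V).card = p
  card_nonadj : ∀ u v, Γ.Adj u v → ({x | Γ.Adj u x ∧ x ≠ v ∧ ¬ Γ.Adj v x} : Finset V).card = r
  card_common_adj : ∀ u v, Γ.Adj u v → ({x | Γ.Adj u x ∧ Γ.Adj v x} : Finset V).card = r
  card_common_distTwo : ∀ u w, DistTwo Γ u w →
    ({x | Γ.Adj u x ∧ Γ.Adj w x} : Finset V).card = r

section Counting

variable {V : Type*} [Fintype V] [DecidableEq V] {Γ : SimpleGraph V} [DecidableRel Γ.Adj]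
  {p r c : ℕ}

theorem card_common_add_card_nonadj (hN : ∀ u, ({x | Γ.Adj u x} : Finset V).card = p)
    {u v : V} (huv : Γ.Adj u v) :
    ({x | Γ.Adj u x ∧ Γ.Adj v x} : Finset V).card +
      ({x | Γ.Adj u x ∧ x ≠ v ∧ ¬ Γ.Adj v x} : Finset V).card + 1 = p := by
  rw [← hN u, ← Finset.card_filter_add_card_filter_not (s := ({x | Γ.Adj u x} : Finset V)) (Γ.Adj v),
    Finset.filter_filter, Finset.filter_filter, add_assoc]
  congr 1
  have : ({x | Γ.Adj u x ∧ ¬ Γ.Adj v x} : Finset V) =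
      insert v ({x | Γ.Adj u x ∧ x ≠ v ∧ ¬ Γ.Adj v x} : Finset V) := by
    ext x
    simp only [Finset.mem_filter, Finset.mem_univ, true_and, Finset.mem_insert]
    constructor
    · intro h
      by_cases hx : x = v <;> tauto
    · rintro (rfl | h)
      · exact ⟨huv, Γ.irrefl⟩
      · exact ⟨h.1, h.2.2⟩
  rw [this, Finset.card_insert_of_notMem (by simp)]

theorem exists_forall_card_eq {α : Type*} {P : α → Prop} (f : α → ℕ)
    (h : ∀ a b, P a → P b → f a = f b) : ∃ n, ∀ a, P a → f a = n := by
  by_cases hex : ∃ a, P a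
  · obtain ⟨a, ha⟩ := hex
    exact ⟨f a, fun b hb => h b a hb ha⟩
  · exact ⟨0, fun a ha => absurd ⟨a, ha⟩ hex⟩

theorem exists_card_nonadj (hat : ArcTransitive Γ) : ∃ r, ∀ u v, Γ.Adj u v →
    ({x | Γ.Adj u x ∧ x ≠ v ∧ ¬ Γ.Adj v x} : Finset V).card = r := by
  obtain ⟨r, hr⟩ := exists_forall_card_eq (P := fun a : V × V => Γ.Adj a.1 a.2)
    (fun a => ({x | Γ.Adj a.1 x ∧ x ≠ a.2 ∧ ¬ Γ.Adj a.2 x} : Finset V).card) (by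
      rintro ⟨u, v⟩ ⟨u', v'⟩ h h'
      obtain ⟨φ, rfl, rfl⟩ := hat h h'
      exact card_filter_eq_of_equiv φ.toEquiv fun x => by simp [φ.map_adj_iff])
  exact ⟨r, fun u v h => hr (u, v) h⟩

omit [DecidableEq V] in
theorem exists_card_common_distTwo (h : TwoGeodesicTransitive Γ) : ∃ c, ∀ u w, DistTwo Γ u w →
    ({x | Γ.Adj u x ∧ Γ.Adj w x} : Finset V).card = c := by
  obtain ⟨c, hc⟩ := exists_forall_card_eq (P := fun a : V × V => DistTwo Γ a.1 a.2)
    (fun a => ({x | Γ.Adj a.1 x ∧ Γ.Adj a.2 x} : Finset V).card) (by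
      rintro ⟨u, w⟩ ⟨u', w'⟩ ⟨h1, h2, v, h3, h4⟩ ⟨h1', h2', v', h3', h4'⟩
      obtain ⟨φ, rfl, -, rfl⟩ := h.2 ⟨h3, h4, h1, h2⟩ ⟨h3', h4', h1', h2'⟩
      exact card_filter_eq_of_equiv φ.toEquiv fun x => by simp [φ.map_adj_iff])
  exact ⟨c, fun u w h => hc (u, w) h⟩

/-- Double counting the edges between the first two spheres around a vertex. -/
theorem card_distTwo_mul [DecidableRel (DistTwo Γ)]
    (hN : ∀ u, ({x | Γ.Adj u x} : Finset V).card = p)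
    (hr : ∀ u v, Γ.Adj u v → ({x | Γ.Adj u x ∧ x ≠ v ∧ ¬ Γ.Adj v x} : Finset V).card = r)
    (hc : ∀ u w, DistTwo Γ u w → ({x | Γ.Adj u x ∧ Γ.Adj w x} : Finset V).card = c) (u : V) :
    p * r = ({w | DistTwo Γ u w} : Finset V).card * c := by
  rw [← hN u]
  refine Finset.card_mul_eq_card_mul Γ.Adj ?_ ?_
  · intro v hv
    simp only [Finset.mem_filter, Finset.mem_univ, true_and] at hv
    rw [← hr v u hv.symm, Finset.bipartiteAbove, Finset.filter_filter]
    congr 1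
    ext w
    simp only [Finset.mem_filter, Finset.mem_univ, true_and]
    simp only [DistTwo]
    constructor
    · rintro ⟨⟨h1, h2, -⟩, h⟩
      exact ⟨h, h1.symm, h2⟩
    · rintro ⟨h, h1, h2⟩
      exact ⟨⟨h1.symm, h2, v, hv, h⟩, h⟩
  · intro w hw
    simp only [Finset.mem_filter, Finset.mem_univ, true_and] at hw
    rw [← hc u w hw, Finset.bipartiteBelow, Finset.filter_filter]
    simp only [Γ.adj_comm w]

/-- A lower bound for the number of common neighbours of two vertices at distance two. -/
theorem add_one_le_two_mul_add (hN : ∀ u, ({x | Γ.Adj u x} : Finset V).card = p)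
    (hr : ∀ u v, Γ.Adj u v → ({x | Γ.Adj u x ∧ x ≠ v ∧ ¬ Γ.Adj v x} : Finset V).card = r)
    (hc : ∀ u w, DistTwo Γ u w → ({x | Γ.Adj u x ∧ Γ.Adj w x} : Finset V).card = c) {u v w : V}
    (huv : Γ.Adj u v) (huw : Γ.Adj u w) (hvw : v ≠ w) (hnon : ¬ Γ.Adj v w) :
    p + 1 ≤ 2 * r + c := by
  have h1 := card_common_add_card_nonadj hN huv
  have h2 := card_common_add_card_nonadj hN huw
  have h3 := hc v w ⟨hvw, hnon, u, huv.symm, huw⟩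
  rw [hr u v huv] at h1
  rw [hr u w huw] at h2
  have h4 := Finset.card_union_add_card_inter ({x | Γ.Adj u x ∧ Γ.Adj v x} : Finset V)
    ({x | Γ.Adj u x ∧ Γ.Adj w x} : Finset V)
  have h5 : (({x | Γ.Adj u x ∧ Γ.Adj v x} : Finset V) ∪
      ({x | Γ.Adj u x ∧ Γ.Adj w x} : Finset V)).card + 2 ≤ p := by
    rw [← hN u, ← Finset.card_pair hvw, ← Finset.card_union_of_disjoint]
    · refine Finset.card_le_card fun x => ?_
      simp only [Finset.mem_union, Finset.mem_filter, Finset.mem_univ, true_and, Finset.mem_insert,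
        Finset.mem_singleton]
      rintro ((h | h) | rfl | rfl)
      exacts [h.1, h.1, huv, huw]
    · rw [Finset.disjoint_right]
      simp only [Finset.mem_union, Finset.mem_filter, Finset.mem_univ, true_and, Finset.mem_insert,
        Finset.mem_singleton]
      rintro x (rfl | rfl)
      · simp [Γ.adj_comm w, hnon]
      · simp [hnon]
  have h6 : (({x | Γ.Adj u x ∧ Γ.Adj v x} : Finset V) ∩
      ({x | Γ.Adj u x ∧ Γ.Adj w x} : Finset V)).card + 1 ≤ c := by
    rw [← h3, ← Finset.card_insert_of_notMem (a := u) (by simp)]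
    refine Finset.card_le_card fun x => ?_
    simp only [Finset.mem_inter, Finset.mem_filter, Finset.mem_univ, true_and, Finset.mem_insert]
    rintro (rfl | h)
    · exact ⟨huv.symm, huw.symm⟩
    · exact ⟨h.1.2, h.2.2⟩
  omega

omit [DecidableEq V] in
/-- Two vertices at distance two do not have the same neighbourhood. -/
theorem card_common_ne [Fact p.Prime] (hN : ∀ u, ({x | Γ.Adj u x} : Finset V).card = p)
    (hc : ∀ u w, DistTwo Γ u w → ({x | Γ.Adj u x ∧ Γ.Adj w x} : Finset V).card = c) {u : V}
    {e : ZMod p ≃ Γ.neighborSet u} (he : IsLocalCoordinate Γ u e)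
    (hnon : ∃ d, d ≠ 0 ∧ ¬ Γ.Adj (e 0) (e d)) (htri : ∃ x, Γ.Adj (e 0) (e x)) : c ≠ p := by
  rintro rfl
  have hsame : ∀ v w, DistTwo Γ v w → ∀ x, Γ.Adj v x ↔ Γ.Adj w x := by
    intro v w h x
    have hsub : ∀ v', (v' = v ∨ v' = w) →
        ({x | Γ.Adj v x ∧ Γ.Adj w x} : Finset V) = ({x | Γ.Adj v' x} : Finset V) := by
      intro v' hv'
      refine Finset.eq_of_subset_of_card_le (fun y => ?_) (by rw [hc v w h, hN])
      simp only [Finset.mem_filter, Finset.mem_univ, true_and]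
      rcases hv' with rfl | rfl <;> tauto
    have := congrArg (x ∈ ·) ((hsub v (Or.inl rfl)).symm.trans (hsub w (Or.inr rfl)))
    simpa using this
  obtain ⟨d, hd0, hd⟩ := hnon
  have hstep : ∀ x y, Γ.Adj (e x) y ↔ Γ.Adj (e (x + d)) y := by
    intro x y
    refine hsame _ _ ⟨?_, ?_, u, (e x).2.symm, (e _).2⟩ y
    · rw [Ne, Subtype.val_injective.eq_iff, e.injective.eq_iff]
      simpa using hd0
    · rwa [he.adj_iff, add_sub_cancel_left]
  have hall : ∀ (n : ℕ) y, Γ.Adj (e 0) y ↔ Γ.Adj (e (n * d)) y := by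
    intro n
    induction n with
    | zero => simp
    | succ n ih =>
      intro y
      rw [ih, hstep]
      push_cast
      rw [add_mul, one_mul]
  obtain ⟨x, hx⟩ := htri
  have := hall (x * d⁻¹).val (e x)
  rw [ZMod.natCast_zmod_val, inv_mul_cancel_right₀ hd0] at this
  exact Γ.irrefl (this.1 hx)

omit [DecidableEq V] in
theorem card_le_of_common (hN : ∀ u, ({x | Γ.Adj u x} : Finset V).card = p) (u w : V) :
    ({x | Γ.Adj u x ∧ Γ.Adj w x} : Finset V).card ≤ p := by
  rw [← hN u]
  exact Finset.card_le_card fun x => by simp +contextual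

omit [DecidableEq V] in
/-- Two vertices at distance two have more than `(p - 1) / 4` common neighbours, if the
neighbourhood of one of these is a Paley graph. -/
theorem add_four_le_four_mul [Fact p.Prime] (h4 : p % 4 = 1) {u v w : V}
    (e : ZMod p ≃ Γ.neighborSet u) (he : ∀ x y, Γ.Adj (e x) (e y) ↔ x ≠ y ∧ IsSquare (x - y))
    (huv : Γ.Adj u v) (huw : Γ.Adj u w) (hvw : v ≠ w) (hnon : ¬ Γ.Adj v w) :
    p + 3 ≤ 4 * ({x | Γ.Adj v x ∧ Γ.Adj w x} : Finset V).card := by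
  classical
  have hcoord : ∀ y, Γ.Adj u y → ∃ t, (e t : V) = y := fun y hy => ⟨e.symm ⟨y, hy⟩, by simp⟩
  obtain ⟨a, rfl⟩ := hcoord v huv
  obtain ⟨b, rfl⟩ := hcoord w huw
  have hab : a ≠ b := by rintro rfl; exact hvw rfl
  have hab' := sub_ne_zero.2 hab
  have hns : ¬ IsSquare (a - b) := fun h => hnon ((he a b).2 ⟨hab, h⟩)
  obtain ⟨h1, -⟩ := four_mul_card_nonsquare_pairs h4
  let f : ZMod p → V := fun t => e (b + t * (a - b))
  have hf : Function.Injective f := by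
    intro s t hst
    have := e.injective (Subtype.val_injective hst)
    exact mul_right_cancel₀ hab' (add_left_cancel this)
  have hle : (insert u (({t | ¬ IsSquare t ∧ ¬ IsSquare (t - 1)} : Finset (ZMod p)).image f)).card ≤
      ({x | Γ.Adj (e a) x ∧ Γ.Adj (e b) x} : Finset V).card := by
    refine Finset.card_le_card fun x => ?_
    simp only [Finset.mem_insert, Finset.mem_image, Finset.mem_filter, Finset.mem_univ, true_and]
    rintro (rfl | ⟨t, ⟨ht, ht'⟩, rfl⟩)
    · exact ⟨(e a).2.symm, (e b).2.symm⟩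
    · have ht0 : t ≠ 0 := by rintro rfl; exact ht .zero
      have ht1 : t - 1 ≠ 0 := by
        intro h; rw [sub_eq_zero.1 h] at ht; exact ht .one
      have e1 : b + t * (a - b) - a = (t - 1) * (a - b) := by ring
      have e2 : b + t * (a - b) - b = t * (a - b) := by ring
      rw [Γ.adj_comm, he, Γ.adj_comm, he, ← sub_ne_zero, ← sub_ne_zero (a := b + _) (b := b), e1, e2,
        isSquare_mul_iff ht0 hab', isSquare_mul_iff ht1 hab']
      exact ⟨⟨mul_ne_zero ht1 hab', by tauto⟩, mul_ne_zero ht0 hab', by tauto⟩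
  rw [Finset.card_insert_of_notMem, Finset.card_image_of_injective _ hf] at hle
  · have := (Fact.out : p.Prime).two_le
    omega
  · simp only [Finset.mem_image, not_exists, not_and]
    rintro t - h
    have h' : Γ.Adj u (f t) := (e _).2
    rw [h] at h'
    exact Γ.irrefl h'

end Counting

section LocallyPaley

variable {V : Type*} {Γ : SimpleGraph V} {p : ℕ}

/-- In an arc transitive graph without isolated vertices, a configuration of two distinct neighbours
of a vertex occurs at every vertex. -/
theorem exists_neighbors_of_arcTransitive (hat : ArcTransitive Γ) (hnb : ∀ u, ∃ v, Γ.Adj u v)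
    (Q : Prop → Prop) (h : ∃ v u w, Γ.Adj v u ∧ Γ.Adj u w ∧ v ≠ w ∧ Q (Γ.Adj v w)) (u : V) :
    ∃ v w, Γ.Adj u v ∧ Γ.Adj u w ∧ v ≠ w ∧ Q (Γ.Adj v w) := by
  obtain ⟨v₀, u₀, w₀, h1, h2, h3, h4⟩ := h
  obtain ⟨v, hv⟩ := hnb u
  obtain ⟨φ, rfl, rfl⟩ := hat h1.symm hv
  exact ⟨φ v₀, φ w₀, hv, φ.map_adj_iff.2 h2, φ.injective.ne h3, by rwa [φ.map_adj_iff]⟩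

theorem exists_isLocallyPaley [Fintype V] [DecidableEq V] [DecidableRel Γ.Adj] [Nonempty V]
    [Fact p.Prime] (hN : ∀ u, ({x | Γ.Adj u x} : Finset V).card = p) (h : TwoGeodesicTransitive Γ)
    (hloc : ∀ u, ∃ e : ZMod p ≃ Γ.neighborSet u, IsLocalCoordinate Γ u e)
    (hnon : ∀ u, ∃ v w, Γ.Adj u v ∧ Γ.Adj u w ∧ v ≠ w ∧ ¬ Γ.Adj v w)
    (htri : ∀ u, ∃ v w, Γ.Adj u v ∧ Γ.Adj u w ∧ v ≠ w ∧ Γ.Adj v w) :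
    ∃ r, IsLocallyPaley Γ p r := by
  classical
  have hp := (Fact.out : p.Prime).two_le
  obtain ⟨r, hr⟩ := exists_card_nonadj h.1
  obtain ⟨c, hc⟩ := exists_card_common_distTwo h
  let S : ∀ {u : V}, (ZMod p ≃ Γ.neighborSet u) → Finset (ZMod p) := fun e =>
    {d | d ≠ 0 ∧ ¬ Γ.Adj (e 0) (e d)}
  have hSmem : ∀ {u : V} (e : ZMod p ≃ Γ.neighborSet u) d,
      d ∈ S e ↔ d ≠ 0 ∧ ¬ Γ.Adj (e 0) (e d) := by
    intro u e d
    simp [S]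
  have hScard : ∀ {u : V} (e : ZMod p ≃ Γ.neighborSet u), (S e).card = r := by
    intro u e
    rw [← hr u (e 0) (e 0).2]
    refine Finset.card_bij (fun d _ => (e d : V)) ?_ ?_ ?_
    · intro d hd
      rw [hSmem] at hd
      rw [Finset.mem_filter]
      refine ⟨Finset.mem_univ _, (e d).2, ?_, hd.2⟩
      rw [Ne, Subtype.val_injective.eq_iff, e.injective.eq_iff]
      exact hd.1
    · intro a _ b _ hab
      exact e.injective (Subtype.val_injective hab)
    · intro x hx
      rw [Finset.mem_filter] at hx
      obtain ⟨-, h1, h2, h3⟩ := hx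
      refine ⟨e.symm ⟨x, h1⟩, ?_, by simp⟩
      rw [hSmem]
      refine ⟨?_, by simpa using h3⟩
      intro h0
      rw [Equiv.symm_apply_eq] at h0
      exact h2 (congrArg Subtype.val h0)
  have hSne : ∀ {u : V} {e : ZMod p ≃ Γ.neighborSet u}, IsLocalCoordinate Γ u e →
      (S e).Nonempty := by
    intro u e he
    obtain ⟨v, w, huv, huw, hvw, hvw'⟩ := hnon u
    refine ⟨e.symm ⟨w, huw⟩ - e.symm ⟨v, huv⟩, ?_⟩
    rw [hSmem, ← he.adj_iff, sub_ne_zero]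
    exact ⟨fun h => hvw (congrArg Subtype.val (e.symm.injective h)).symm, by simpa using hvw'⟩
  have htri0 : ∀ {u : V} {e : ZMod p ≃ Γ.neighborSet u}, IsLocalCoordinate Γ u e →
      ∃ x, Γ.Adj (e 0) (e x) := by
    intro u e he
    obtain ⟨v, w, huv, huw, hvw, hvw'⟩ := htri u
    refine ⟨e.symm ⟨w, huw⟩ - e.symm ⟨v, huv⟩, ?_⟩
    rw [← he.adj_iff]
    simpa using hvw'
  have hgrp : ∀ {u : V} {e : ZMod p ≃ Γ.neighborSet u}, IsLocalCoordinate Γ u e →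
      ∃ H : Subgroup (ZMod p)ˣ, (∀ a ∈ H, ∀ d ∈ S e, (a : ZMod p) * d ∈ S e) ∧
        ∀ d ∈ S e, ∀ d' ∈ S e, ∃ a ∈ H, (a : ZMod p) * d = d' := by
    intro u e he
    simp only [hSmem]
    exact he.exists_unit_group h
  have hzero : ∀ {u : V} (e : ZMod p ≃ Γ.neighborSet u), (0 : ZMod p) ∉ S e := by simp [S]
  obtain ⟨u₀⟩ := ‹Nonempty V›
  obtain ⟨hrp, hcr, hrdvd, hcp⟩ : r ∣ p - 1 ∧ c ∣ r ∧ p + 1 ≤ 2 * r + c ∧ r + 1 < p := by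
    obtain ⟨e, he⟩ := hloc u₀
    obtain ⟨H, hH1, hH2⟩ := hgrp he
    have hr1 := card_dvd_sub_one_of_unit_orbit H (S e) (hzero e) hH1 hH2 (hSne he)
    rw [hScard] at hr1
    obtain ⟨d, hd⟩ := hSne he
    have hcp : c ≠ p := card_common_ne hN hc he ⟨d, (hSmem e d).1 hd⟩ (htri0 he)
    obtain ⟨v, w, huv, huw, hvw, hvw'⟩ := hnon u₀
    have hcle : c ≤ p := by
      rw [← hc v w ⟨hvw, hvw', u₀, huv.symm, huw⟩]
      exact card_le_of_common hN v w
    have hc0 : c ≠ 0 := by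
      rw [← hc v w ⟨hvw, hvw', u₀, huv.symm, huw⟩]
      exact Finset.card_ne_zero_of_mem (a := u₀) (by simp [huv.symm, huw.symm])
    refine ⟨hr1, ?_, add_one_le_two_mul_add hN hr hc huv huw hvw hvw', ?_⟩
    · have hcop : Nat.Coprime c p :=
        ((Nat.Prime.coprime_iff_not_dvd Fact.out).2
          (Nat.not_dvd_of_pos_of_lt (by omega) (by omega))).symm
      exact hcop.dvd_of_dvd_mul_left ⟨_, (card_distTwo_mul hN hr hc u₀).trans (mul_comm _ _)⟩
    · obtain ⟨x, hx⟩ := htri0 he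
      have h1 := card_common_add_card_nonadj hN (e 0).2
      rw [hr _ _ (e 0).2] at h1
      have : 0 < ({x | Γ.Adj u₀ x ∧ Γ.Adj (e 0) x} : Finset V).card :=
        Finset.card_pos.2 ⟨e x, by simpa using ⟨(e x).2, hx⟩⟩
      omega
  have hr0 : r ≠ 0 := by
    rintro rfl
    rw [Nat.zero_dvd] at hrp
    omega
  have h2r : 2 * r + 1 = p := by
    obtain ⟨q, hq⟩ := hrp
    have hcle := Nat.le_of_dvd (by omega) hcr
    have hq1 : q ≠ 1 := by rintro rfl; omega
    have hq0 : q ≠ 0 := by rintro rfl; omega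
    have hq3 : q < 3 := by
      by_contra! hq3
      have := Nat.mul_le_mul_left r hq3
      omega
    have : q = 2 := by omega
    subst this
    omega
  have hcoord : ∀ u, ∃ e : ZMod p ≃ Γ.neighborSet u, ∀ x y,
      Γ.Adj (e x) (e y) ↔ x ≠ y ∧ IsSquare (x - y) := by
    intro u
    obtain ⟨e, he⟩ := hloc u
    obtain ⟨H, hH1, hH2⟩ := hgrp he
    obtain ⟨a, ha, hS⟩ := exists_mem_iff_not_isSquare_of_card H (S e) (hzero e) hH1 hH2 (hSne he)
      (by rw [hScard, h2r])
    have key : ∀ x y, Γ.Adj (e x) (e y) ↔ x ≠ y ∧ IsSquare (a * (y - x)) := by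
      intro x y
      rcases eq_or_ne x y with rfl | hxy
      · simp
      · have := hS (y - x) (sub_ne_zero.2 hxy.symm)
        rw [hSmem, sub_ne_zero] at this
        rw [he.adj_iff]
        tauto
    refine ⟨(Equiv.mulLeft₀ a⁻¹ (inv_ne_zero ha)).trans e, fun x y => ?_⟩
    rw [Γ.adj_comm]
    simp only [Equiv.trans_apply, Equiv.mulLeft₀_apply]
    rw [key, ← mul_sub, mul_inv_cancel_left₀ ha, (mul_right_injective₀ (inv_ne_zero ha)).ne_iff,
      ne_comm]
  have h4 : p % 4 = 1 := by
    obtain ⟨e, he⟩ := hloc u₀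
    obtain ⟨H, hH1, hH2⟩ := hgrp he
    refine mod_four_eq_one_of_card H (S e) (hzero e) hH1 hH2 (hSne he) (by rw [hScard, h2r]) ?_
    intro d hd
    rw [hSmem] at hd ⊢
    refine ⟨neg_ne_zero.2 hd.1, ?_⟩
    rw [← zero_sub, ← he.adj_iff, Γ.adj_comm]
    exact hd.2
  have hcr' : c = r := by
    obtain ⟨v, w, huv, huw, hvw, hvw'⟩ := hnon u₀
    obtain ⟨e, he⟩ := hcoord u₀
    have h1 := add_four_le_four_mul h4 e he huv huw hvw hvw'
    rw [hc v w ⟨hvw, hvw', u₀, huv.symm, huw⟩] at h1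
    obtain ⟨q, rfl⟩ := hcr
    have hq : q < 2 := by
      by_contra! hq
      have := Nat.mul_le_mul_left c hq
      omega
    have : q = 1 := by
      have : q ≠ 0 := by rintro rfl; exact hr0 (mul_zero c)
      omega
    rw [this, mul_one]
  refine ⟨r, h2r, h4, hcoord, hN, hr, ?_, fun u w huw => by rw [hc u w huw, hcr']⟩
  intro u v huv
  have := card_common_add_card_nonadj hN huv
  rw [hr u v huv] at this
  omega

end LocallyPaley

/-- `x` is at distance at least three from `u`. -/
def Far {V : Type*} (Γ : SimpleGraph V) (u x : V) : Prop :=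
  u ≠ x ∧ ¬ Γ.Adj u x ∧ ∀ v, Γ.Adj u v → ¬ Γ.Adj v x

theorem Far.symm {V : Type*} {Γ : SimpleGraph V} {u x : V} (h : Far Γ u x) : Far Γ x u :=
  ⟨h.1.symm, fun h' => h.2.1 h'.symm, fun v h1 h2 => h.2.2 v h2.symm h1.symm⟩

theorem not_distTwo_self {V : Type*} (Γ : SimpleGraph V) (u : V) : ¬ DistTwo Γ u u :=
  fun h => h.1 rfl

theorem eq_or_adj_or_distTwo_or_far {V : Type*} (Γ : SimpleGraph V) (u x : V) :
    x = u ∨ Γ.Adj u x ∨ DistTwo Γ u x ∨ Far Γ u x := by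
  by_cases h1 : x = u
  · exact .inl h1
  by_cases h2 : Γ.Adj u x
  · exact .inr (.inl h2)
  by_cases h3 : ∃ v, Γ.Adj u v ∧ Γ.Adj v x
  · exact .inr (.inr (.inl ⟨Ne.symm h1, h2, h3⟩))
  · exact .inr (.inr (.inr ⟨Ne.symm h1, h2, fun v hv hv' => h3 ⟨v, hv, hv'⟩⟩))

namespace IsLocallyPaley

variable {V : Type*} [Fintype V] [DecidableEq V] {Γ : SimpleGraph V} [DecidableRel Γ.Adj]
  {p r : ℕ} [Fact p.Prime] {u w y z : V}

theorem pos (h : IsLocallyPaley Γ p r) : 0 < r := by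
  have := h.two_mul_add_one
  have := (Fact.out : p.Prime).two_le
  omega

theorem card_distTwo [DecidableRel (DistTwo Γ)] (h : IsLocallyPaley Γ p r) (u : V) :
    ({w | DistTwo Γ u w} : Finset V).card = p :=
  (Nat.eq_of_mul_eq_mul_right h.pos
    (card_distTwo_mul h.card_neighbors h.card_nonadj h.card_common_distTwo u)).symm

omit [Fact p.Prime] in
/-- If `y` is a neighbour of `w`, where `w` is at distance two from `u` and `y` is at distance at
least three, then `y` is adjacent to all other neighbours of `w` which are not adjacent to `u`. -/
theorem adj_far_iff (h : IsLocallyPaley Γ p r) (huw : DistTwo Γ u w) (hwy : Γ.Adj w y)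
    (hy : Far Γ u y) {x : V} (hx : Γ.Adj w x) : Γ.Adj y x ↔ x ≠ y ∧ ¬ Γ.Adj u x := by
  have hsub : ({x | Γ.Adj w x ∧ Γ.Adj y x} : Finset V) ⊆
      ({x | Γ.Adj w x ∧ ¬ Γ.Adj u x} : Finset V).erase y := by
    intro x
    simp only [Finset.mem_filter, Finset.mem_univ, true_and, Finset.mem_erase]
    exact fun hx => ⟨hx.2.ne', hx.1, fun hu => hy.2.2 x hu hx.2.symm⟩
  have hcard : ({x | Γ.Adj w x ∧ ¬ Γ.Adj u x} : Finset V).card + r = p := by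
    rw [← h.card_neighbors w, ← h.card_common_distTwo u w huw, add_comm,
      ← Finset.card_filter_add_card_filter_not (s := ({x | Γ.Adj w x} : Finset V)) (Γ.Adj u),
      Finset.filter_filter, Finset.filter_filter]
    simp only [and_comm]
  have hmem : y ∈ ({x | Γ.Adj w x ∧ ¬ Γ.Adj u x} : Finset V) := by simpa using ⟨hwy, hy.2.1⟩
  have heq := Finset.eq_of_subset_of_card_le hsub (by
    have := h.two_mul_add_one
    rw [h.card_common_adj w y hwy, Finset.card_erase_of_mem hmem]
    omega)
  have := Finset.ext_iff.1 heq x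
  simpa [hx] using this

theorem far_unique (h : IsLocallyPaley Γ p r) (huw : DistTwo Γ u w) (hwy : Γ.Adj w y)
    (hy : Far Γ u y) (hwz : Γ.Adj w z) (hz : Far Γ u z) : y = z := by
  by_contra hyz
  obtain ⟨e, he⟩ := h.coordinate w
  obtain ⟨a, rfl⟩ : ∃ t, (e t : V) = y := ⟨e.symm ⟨y, hwy⟩, by simp⟩
  obtain ⟨b, rfl⟩ : ∃ t, (e t : V) = z := ⟨e.symm ⟨z, hwz⟩, by simp⟩
  have hadj := (h.adj_far_iff huw hwy hy hwz).2 ⟨Ne.symm hyz, hz.2.1⟩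
  rw [he] at hadj
  obtain ⟨x, hxa, hxb, hsa, hsb⟩ := exists_isSquare_sub_and_not h.mod_four hadj.1 hadj.2
  have hna : ∀ t, x ≠ t → (e x : V) ≠ e t := fun t ht h' =>
    ht (e.injective (Subtype.val_injective h'))
  have h1 := h.adj_far_iff huw hwy hy (e x).2
  have h2 := h.adj_far_iff huw hwz hz (e x).2
  rw [Γ.adj_comm, he] at h1 h2
  have := hna a hxa
  have := hna b hxb
  tauto

theorem exists_far (h : IsLocallyPaley Γ p r) (u : V) : ∃ z, Far Γ u z := by
  classical
  by_contra! hfar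
  have huniv : (Finset.univ : Finset V) =
      insert u (({x | Γ.Adj u x} : Finset V) ∪ ({x | DistTwo Γ u x} : Finset V)) := by
    ext x
    have := eq_or_adj_or_distTwo_or_far Γ u x
    have := hfar x
    simp only [Finset.mem_univ, Finset.mem_insert, Finset.mem_union, Finset.mem_filter, true_and,
      true_iff]
    tauto
  have hcard : Fintype.card V = p + p + 1 := by
    rw [← Finset.card_univ, huniv, Finset.card_insert_of_notMem, Finset.card_union_of_disjoint,
      h.card_neighbors, h.card_distTwo]
    · rw [Finset.disjoint_left]
      simp only [Finset.mem_filter, Finset.mem_univ, true_and]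
      exact fun x hx hx' => hx'.2.1 hx
    · simp [not_distTwo_self]
  have hsum := Γ.sum_degrees_eq_twice_card_edges
  have hdeg : ∀ v, Γ.degree v = p := by
    intro v
    rw [← Γ.card_neighborFinset_eq_degree, ← h.card_neighbors v, Γ.neighborFinset_eq_filter]
  simp only [hdeg, Finset.sum_const, Finset.card_univ, hcard, smul_eq_mul] at hsum
  have h4 := h.two_mul_add_one
  have hodd : Odd ((p + p + 1) * p) := Odd.mul ⟨p, by ring⟩ ⟨r, h4.symm⟩
  exact (Nat.not_even_iff_odd.2 hodd) ⟨_, hsum.trans (two_mul _)⟩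

theorem exists_far_adj (h : IsLocallyPaley Γ p r) (hconn : Γ.Connected)
    (h2 : TwoGeodesicTransitive Γ) (huw : DistTwo Γ u w) : ∃ y, Γ.Adj w y ∧ Far Γ u y := by
  obtain ⟨w', hw', y, hy, hfar⟩ : ∃ w', DistTwo Γ u w' ∧ ∃ y, Γ.Adj w' y ∧ Far Γ u y := by
    by_contra! hno
    obtain ⟨z, hz⟩ := h.exists_far u
    have := connected_induction hconn (x := u) (fun x => x = u ∨ Γ.Adj u x ∨ DistTwo Γ u x)
      (.inl rfl) (by
        rintro a b ha hab
        rcases eq_or_adj_or_distTwo_or_far Γ u b with hb | hb | hb | hb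
        · exact .inl hb
        · exact .inr (.inl hb)
        · exact .inr (.inr hb)
        · rcases ha with rfl | ha | ha
          · exact absurd hab hb.2.1
          · exact absurd hab (hb.2.2 _ ha)
          · exact absurd hb (hno a ha b hab)) z
    rcases this with h' | h' | ⟨-, -, v, h', h''⟩
    · exact hz.1 h'.symm
    · exact hz.2.1 h'
    · exact hz.2.2 v h' h''
  obtain ⟨h3, h4, v, h5, h6⟩ := huw
  obtain ⟨h3', h4', v', h5', h6'⟩ := hw'
  obtain ⟨φ, hu, hv, rfl⟩ := h2.2 (v' := u) (u' := v) (w' := w) ⟨h5', h6', h3', h4'⟩ ⟨h5, h6, h3, h4⟩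
  refine ⟨φ y, φ.map_adj_iff.2 hy, ?_, ?_, ?_⟩
  · rw [← hu]
    exact φ.injective.ne hfar.1
  · rw [← hu, φ.map_adj_iff]
    exact hfar.2.1
  · intro x
    obtain ⟨x, rfl⟩ := φ.surjective x
    rw [← hu, φ.map_adj_iff, φ.map_adj_iff]
    exact hfar.2.2 x

theorem lt_card_adj_distTwo [DecidableRel (DistTwo Γ)] (h : IsLocallyPaley Γ p r)
    (huw : DistTwo Γ u w) (hwy : Γ.Adj w y) (hy : Far Γ u y) :
    r < ({x | DistTwo Γ u x ∧ Γ.Adj y x} : Finset V).card := by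
  rw [← h.card_common_adj w y hwy, ← Nat.succ_le_iff, Nat.succ_eq_add_one,
    ← Finset.card_insert_of_notMem (a := w) (by simp)]
  refine Finset.card_le_card fun x => ?_
  simp only [Finset.mem_filter, Finset.mem_univ, true_and, Finset.mem_insert]
  rintro (rfl | ⟨hx, hx'⟩)
  · exact ⟨huw, hwy.symm⟩
  · refine ⟨?_, hx'⟩
    rcases eq_or_adj_or_distTwo_or_far Γ u x with hc | hc | hc | hc
    · subst hc
      exact absurd hx'.symm hy.2.1
    · exact absurd hc ((h.adj_far_iff huw hwy hy hx).1 hx').2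
    · exact hc
    · rw [h.far_unique huw hwy hy hx hc] at hx'
      exact absurd hx' Γ.irrefl

/-- The graph is an antipodal double cover of a complete graph. -/
theorem exists_antipode (h : IsLocallyPaley Γ p r) (hconn : Γ.Connected)
    (h2 : TwoGeodesicTransitive Γ) (u : V) : ∃ z, (∀ x, Far Γ u x ↔ x = z) ∧
      ∀ x, Γ.Adj z x ↔ DistTwo Γ u x := by
  classical
  have hD := h.card_distTwo u
  have huniq : ∀ w w' y y', DistTwo Γ u w → DistTwo Γ u w' → Γ.Adj w y → Γ.Adj w' y' →
      Far Γ u y → Far Γ u y' → y = y' := by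
    intro w w' y y' hw hw' hwy hwy' hy hy'
    by_contra hne
    have h1 := h.lt_card_adj_distTwo hw hwy hy
    have h2 := h.lt_card_adj_distTwo hw' hwy' hy'
    have h3 := h.two_mul_add_one
    have h4 : Disjoint ({x | DistTwo Γ u x ∧ Γ.Adj y x} : Finset V)
        ({x | DistTwo Γ u x ∧ Γ.Adj y' x} : Finset V) := by
      rw [Finset.disjoint_left]
      simp only [Finset.mem_filter, Finset.mem_univ, true_and]
      exact fun x hx hx' => hne (h.far_unique hx.1 hx.2.symm hy hx'.2.symm hy')
    have h5 : (({x | DistTwo Γ u x ∧ Γ.Adj y x} : Finset V) ∪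
        ({x | DistTwo Γ u x ∧ Γ.Adj y' x} : Finset V)).card ≤ p := by
      rw [← hD]
      refine Finset.card_le_card fun x => ?_
      simp only [Finset.mem_filter, Finset.mem_univ, true_and, Finset.mem_union]
      tauto
    rw [Finset.card_union_of_disjoint h4] at h5
    omega
  obtain ⟨w₀, hw₀⟩ : ({w | DistTwo Γ u w} : Finset V).Nonempty :=
    Finset.card_pos.1 (by rw [hD]; exact (Fact.out : p.Prime).pos)
  rw [Finset.mem_filter] at hw₀
  obtain ⟨z, hz, hzfar⟩ := h.exists_far_adj hconn h2 hw₀.2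
  have hDz : ∀ w, DistTwo Γ u w → Γ.Adj z w := by
    intro w hw
    obtain ⟨z', hz', hzfar'⟩ := h.exists_far_adj hconn h2 hw
    rw [huniq w₀ w z z' hw₀.2 hw hz hz' hzfar hzfar']
    exact hz'.symm
  have heq : ({w | DistTwo Γ u w} : Finset V) = ({x | Γ.Adj z x} : Finset V) := by
    refine Finset.eq_of_subset_of_card_le (fun x => ?_) (by rw [hD, h.card_neighbors])
    simpa using hDz x
  have hNz : ∀ x, Γ.Adj z x ↔ DistTwo Γ u x := by
    intro x
    have := Finset.ext_iff.1 heq x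
    simpa using this.symm
  refine ⟨z, fun x => ⟨fun hx => ?_, ?_⟩, hNz⟩
  · have := connected_induction hconn (x := u) (fun x => Far Γ u x → x = z)
      (fun hu => absurd rfl hu.1) (by
        intro a b ha hab hb
        rcases eq_or_adj_or_distTwo_or_far Γ u a with rfl | hc | hc | hc
        · exact absurd hab hb.2.1
        · exact absurd hab (hb.2.2 a hc)
        · exact huniq a w₀ b z hc hw₀.2 hab hz hb hzfar
        · rw [ha hc, hNz] at hab
          obtain ⟨-, -, v, h1, h2⟩ := hab
          exact absurd h2 (hb.2.2 v h1)) x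
    exact this hx
  · rintro rfl
    exact hzfar

theorem card_eq (h : IsLocallyPaley Γ p r) (hconn : Γ.Connected)
    (h2 : TwoGeodesicTransitive Γ) : Fintype.card V = 2 * (p + 1) := by
  classical
  obtain ⟨u⟩ := hconn.nonempty
  obtain ⟨z, hz, hNz⟩ := h.exists_antipode hconn h2 u
  have huz := (hz z).2 rfl
  have huniv : (Finset.univ : Finset V) =
      insert u (insert z (({x | Γ.Adj u x} : Finset V) ∪ ({x | DistTwo Γ u x} : Finset V))) := by
    ext x
    have := eq_or_adj_or_distTwo_or_far Γ u x
    rw [hz] at this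
    simp only [Finset.mem_univ, Finset.mem_insert, Finset.mem_union, Finset.mem_filter, true_and,
      true_iff]
    tauto
  rw [← Finset.card_univ, huniv, Finset.card_insert_of_notMem, Finset.card_insert_of_notMem,
    Finset.card_union_of_disjoint, h.card_neighbors, h.card_distTwo]
  · omega
  · rw [Finset.disjoint_left]
    simp only [Finset.mem_filter, Finset.mem_univ, true_and]
    exact fun x hx hx' => hx'.2.1 hx
  · simp [huz.2.1, ← hNz]
  · simp [not_distTwo_self, huz.1]

/-- The antipodal involution. -/
theorem exists_antipodal_map (h : IsLocallyPaley Γ p r) (hconn : Γ.Connected)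
    (h2 : TwoGeodesicTransitive Γ) : ∃ τ : V → V, (∀ u, τ (τ u) = u) ∧ (∀ u, u ≠ τ u) ∧
      (∀ u, ¬ Γ.Adj u (τ u)) ∧ ∀ u x, x ≠ u → x ≠ τ u → (Γ.Adj (τ u) x ↔ ¬ Γ.Adj u x) := by
  choose τ hτ hN using h.exists_antipode hconn h2
  have hfar : ∀ u, Far Γ u (τ u) := fun u => (hτ u _).2 rfl
  refine ⟨τ, fun u => ((hτ _ _).1 (hfar u).symm).symm, fun u => (hfar u).1, fun u => (hfar u).2.1,
    fun u x hxu hx => ?_⟩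
  rw [hN]
  refine ⟨fun h' => h'.2.1, fun h' => ?_⟩
  have := eq_or_adj_or_distTwo_or_far Γ u x
  rw [hτ] at this
  tauto

end IsLocallyPaley

/-- The determinant of the matrix with columns `v` and `w`. -/
def crossDet {F : Type*} [Field F] (v w : Fin 2 → F) : F :=
  v 0 * w 1 - v 1 * w 0

section CrossDet

variable {F : Type*} [Field F]

theorem crossDet_mulVec (M : Matrix (Fin 2) (Fin 2) F) (v w : Fin 2 → F) :
    crossDet (M.mulVec v) (M.mulVec w) = M.det * crossDet v w := by
  simp only [crossDet, Matrix.mulVec, dotProduct, Fin.sum_univ_two, Matrix.det_fin_two]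
  ring

theorem crossDet_self (v : Fin 2 → F) : crossDet v v = 0 := by
  simp only [crossDet]
  ring

theorem crossDet_smul_left (t : F) (v w : Fin 2 → F) :
    crossDet (t • v) w = t * crossDet v w := by
  simp only [crossDet, Pi.smul_apply, smul_eq_mul]
  ring

theorem crossDet_smul_right (t : F) (v w : Fin 2 → F) :
    crossDet v (t • w) = t * crossDet v w := by
  simp only [crossDet, Pi.smul_apply, smul_eq_mul]
  ring

theorem ne_zero_of_crossDet_ne_zero {v w : Fin 2 → F} (h : crossDet v w ≠ 0) : w ≠ 0 := by
  rintro rfl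
  simp [crossDet] at h

theorem exists_crossDet_eq_one {v : Fin 2 → F} (hv : v ≠ 0) : ∃ w, crossDet v w = 1 := by
  by_cases h0 : v 0 = 0
  · have h1 : v 1 ≠ 0 := by
      intro h1
      apply hv
      ext i
      fin_cases i <;> simp [h0, h1]
    exact ⟨![-(v 1)⁻¹, 0], by simp [crossDet, h1]⟩
  · exact ⟨![0, (v 0)⁻¹], by simp [crossDet, h0]⟩

theorem mulVec_ne_zero {M : Matrix (Fin 2) (Fin 2) F} (hM : M.det ≠ 0) {v : Fin 2 → F}
    (hv : v ≠ 0) : M.mulVec v ≠ 0 :=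
  fun h => hv (Matrix.eq_zero_of_mulVec_eq_zero hM h)

/-- A matrix all of whose nonzero vectors are eigenvectors is scalar. -/
theorem eq_scalar_of_crossDet_mulVec {M : Matrix (Fin 2) (Fin 2) F}
    (h : ∀ v, v ≠ 0 → crossDet (M.mulVec v) v = 0) : M = Matrix.scalar (Fin 2) (M 0 0) := by
  have h1 := h ![1, 0] (fun h => by simpa using congrFun h 0)
  have h2 := h ![0, 1] (fun h => by simpa using congrFun h 1)
  have h3 := h ![1, 1] (fun h => by simpa using congrFun h 0)
  simp only [crossDet, Matrix.mulVec, dotProduct, Fin.sum_univ_two, Matrix.cons_val_zero,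
    Matrix.cons_val_one, mul_one, mul_zero, add_zero, zero_add, sub_zero, zero_sub,
    neg_eq_zero] at h1 h2 h3
  ext i j
  fin_cases i <;> fin_cases j
  · simp
  · simp [h2]
  · simp [h1]
  · simp only [h1, h2, add_zero, zero_add] at h3
    simpa using (sub_eq_zero.1 h3).symm

theorem scalar_mulVec (t : F) (v : Fin 2 → F) :
    (Matrix.scalar (Fin 2) t).mulVec v = t • v := by
  simp [Matrix.scalar_apply, ← Matrix.smul_one_eq_diagonal, Matrix.smul_mulVec]

end CrossDet

/-- The map `π` from the nonzero vectors of `F²` presents the vertices of `Γ` in such a way that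
adjacency is described by the quadratic character of the determinant. -/
structure IsDetModel {V F : Type*} [Field F] (Γ : SimpleGraph V) (π : (Fin 2 → F) → V) : Prop where
  surj : ∀ x, ∃ v, v ≠ 0 ∧ π v = x
  adj_iff : ∀ v w, v ≠ 0 → w ≠ 0 →
    (Γ.Adj (π v) (π w) ↔ crossDet v w ≠ 0 ∧ IsSquare (crossDet v w))
  ext : ∀ x y, (∀ z, Γ.Adj x z ↔ Γ.Adj y z) → x = y

namespace IsDetModel

variable {V F : Type*} [Field F] {Γ : SimpleGraph V} {π : (Fin 2 → F) → V}

theorem crossDet_eq_zero (h : IsDetModel Γ π) {v w : Fin 2 → F} (hv : v ≠ 0) (hw : w ≠ 0)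
    (hvw : π v = π w) : crossDet v w = 0 := by
  by_contra hd
  have h1 : crossDet v w • w ≠ 0 := smul_ne_zero hd hw
  have h2 := h.adj_iff v _ hv h1
  rw [hvw, h.adj_iff w _ hw h1, crossDet_smul_right, crossDet_smul_right, crossDet_self,
    mul_zero] at h2
  exact (h2.2 ⟨mul_ne_zero hd hd, _, rfl⟩).1 rfl

theorem isSquare_of_smul_eq (h : IsDetModel Γ π) {v : Fin 2 → F} {t : F} (hv : v ≠ 0) (ht : t ≠ 0)
    (hvt : π (t • v) = π v) : IsSquare t := by
  obtain ⟨w, hw⟩ := exists_crossDet_eq_one hv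
  have hw0 : w ≠ 0 := ne_zero_of_crossDet_ne_zero (v := v) (by simp [hw])
  have h1 := h.adj_iff (t • v) w (smul_ne_zero ht hv) hw0
  rw [hvt, h.adj_iff v w hv hw0, crossDet_smul_left, hw, mul_one] at h1
  exact (h1.1 ⟨one_ne_zero, .one⟩).2

theorem adj_mulVec_iff (h : IsDetModel Γ π) {M : Matrix (Fin 2) (Fin 2) F} (hM : M.det ≠ 0)
    (hs : IsSquare M.det) {v w : Fin 2 → F} (hv : v ≠ 0) (hw : w ≠ 0) :
    Γ.Adj (π (M.mulVec v)) (π (M.mulVec w)) ↔ Γ.Adj (π v) (π w) := by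
  rw [h.adj_iff _ _ (mulVec_ne_zero hM hv) (mulVec_ne_zero hM hw), h.adj_iff v w hv hw,
    crossDet_mulVec, mul_ne_zero_iff, and_iff_right hM]
  refine and_congr_right fun hd => ⟨fun h1 => ?_, hs.mul⟩
  have := h1.mul hs.inv
  rwa [mul_comm, inv_mul_cancel_left₀ hM] at this

theorem mulVec_eq_iff (h : IsDetModel Γ π) {M : Matrix (Fin 2) (Fin 2) F} (hM : M.det ≠ 0)
    (hs : IsSquare M.det) {v w : Fin 2 → F} (hv : v ≠ 0) (hw : w ≠ 0) :
    π (M.mulVec v) = π (M.mulVec w) ↔ π v = π w := by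
  constructor
  · intro h1
    refine h.ext _ _ fun z => ?_
    obtain ⟨u, hu, rfl⟩ := h.surj z
    rw [← h.adj_mulVec_iff hM hs hv hu, ← h.adj_mulVec_iff hM hs hw hu, h1]
  · intro h1
    refine h.ext _ _ fun z => ?_
    obtain ⟨u, hu, rfl⟩ := h.surj z
    have hu' : u = M.mulVec (M⁻¹.mulVec u) := by
      rw [Matrix.mulVec_mulVec, Matrix.mul_nonsing_inv _ (isUnit_iff_ne_zero.2 hM),
        Matrix.one_mulVec]
    have hne : M⁻¹.mulVec u ≠ 0 := by
      intro h0
      rw [h0, Matrix.mulVec_zero] at hu'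
      exact hu hu'
    rw [hu', h.adj_mulVec_iff hM hs hv hne, h.adj_mulVec_iff hM hs hw hne, h1]

/-- Matrices whose determinant is a nonzero square induce automorphisms. -/
theorem exists_iso [Finite V] (h : IsDetModel Γ π) {M : Matrix (Fin 2) (Fin 2) F} (hM : M.det ≠ 0)
    (hs : IsSquare M.det) : ∃ φ : Γ ≃g Γ, ∀ v, v ≠ 0 → φ (π v) = π (M.mulVec v) := by
  choose s hs0 hs1 using h.surj
  have hf : ∀ v, v ≠ 0 → π (M.mulVec (s (π v))) = π (M.mulVec v) := fun v hv =>
    (h.mulVec_eq_iff hM hs (hs0 _) hv).2 (hs1 _)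
  have hinj : Function.Injective fun x => π (M.mulVec (s x)) := by
    intro x y hxy
    rw [← hs1 x, ← hs1 y]
    exact (h.mulVec_eq_iff hM hs (hs0 _) (hs0 _)).1 hxy
  refine ⟨⟨Equiv.ofBijective _ (Finite.injective_iff_bijective.1 hinj), ?_⟩, hf⟩
  intro x y
  simp only [Equiv.ofBijective_apply]
  rw [h.adj_mulVec_iff hM hs (hs0 _) (hs0 _), hs1, hs1]

theorem iso_ext (h : IsDetModel Γ π) {φ ψ : Γ ≃g Γ} (hφ : ∀ v, v ≠ 0 → φ (π v) = ψ (π v)) :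
    φ = ψ := by
  ext x
  obtain ⟨v, hv, rfl⟩ := h.surj x
  exact hφ v hv

/-- The action of the special linear group by automorphisms. -/
theorem exists_hom [Finite V] (h : IsDetModel Γ π) :
    ∃ Φ : Matrix.SpecialLinearGroup (Fin 2) F →* (Γ ≃g Γ),
      ∀ g v, v ≠ 0 → Φ g (π v) = π (g.1.mulVec v) := by
  choose Φ hΦ using fun g : Matrix.SpecialLinearGroup (Fin 2) F =>
    h.exists_iso (M := g.1) (by simp [g.2]) (by rw [g.2]; exact .one)
  refine ⟨MonoidHom.mk' Φ fun g k => h.iso_ext fun v hv => ?_, hΦ⟩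
  rw [RelIso.mul_apply, hΦ _ v hv, hΦ k v hv, hΦ g _ (mulVec_ne_zero (by simp [k.2]) hv),
    Matrix.mulVec_mulVec]
  rfl

theorem smul_smul_eq (h : IsDetModel Γ π) {n : F} (hn : n ≠ 0) {v : Fin 2 → F} (hv : v ≠ 0) :
    π (n • n • v) = π v := by
  refine h.ext _ _ fun z => ?_
  obtain ⟨u, hu, rfl⟩ := h.surj z
  rw [h.adj_iff _ _ (smul_ne_zero hn (smul_ne_zero hn hv)) hu, h.adj_iff v u hv hu,
    crossDet_smul_left, crossDet_smul_left, ← mul_assoc, mul_ne_zero_iff,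
    and_iff_right (mul_ne_zero hn hn)]
  refine and_congr_right fun _ => ⟨fun h1 => ?_, fun h1 => IsSquare.mul ⟨n, rfl⟩ h1⟩
  have := h1.mul (IsSquare.inv (a := n * n) ⟨n, rfl⟩)
  rwa [mul_comm, inv_mul_cancel_left₀ (mul_ne_zero hn hn)] at this

/-- An injective homomorphism from `Z₂ × PSL₂` to the automorphism group. -/
theorem exists_injective_hom [Finite V] (h : IsDetModel Γ π) (hneg : IsSquare (-1 : F)) {n : F}
    (hn : n ≠ 0) (hns : ¬ IsSquare n) :
    ∃ Ψ : Multiplicative (ZMod 2) × (Matrix.SpecialLinearGroup (Fin 2) F ⧸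
      Subgroup.center (Matrix.SpecialLinearGroup (Fin 2) F)) →* (Γ ≃g Γ),
      Function.Injective Ψ := by
  obtain ⟨Φ, hΦ⟩ := h.exists_hom
  obtain ⟨τ, hτ⟩ := h.exists_iso (M := Matrix.scalar (Fin 2) n) (by simp [hn])
    ⟨n, by simp [pow_two]⟩
  have hτ' : ∀ v, v ≠ 0 → τ (π v) = π (n • v) := by
    intro v hv
    rw [hτ v hv, scalar_mulVec]
  have hτ2 : τ ^ 2 = 1 := by
    refine h.iso_ext fun v hv => ?_
    rw [pow_two, RelIso.mul_apply, hτ' v hv, hτ' _ (smul_ne_zero hn hv), h.smul_smul_eq hn hv]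
    rfl
  have hcomm : ∀ g, τ * Φ g = Φ g * τ := by
    refine fun g => h.iso_ext fun v hv => ?_
    rw [RelIso.mul_apply, RelIso.mul_apply, hΦ g v hv, hτ' v hv,
      hτ' _ (mulVec_ne_zero (by simp [g.2]) hv), hΦ g _ (smul_ne_zero hn hv), Matrix.mulVec_smul]
  have hsq : ∀ a : F, a ^ 2 = 1 → a ≠ 0 ∧ IsSquare a := by
    intro a ha
    rw [pow_two, mul_self_eq_one_iff] at ha
    rcases ha with rfl | rfl
    exacts [⟨one_ne_zero, .one⟩, ⟨neg_ne_zero.2 one_ne_zero, hneg⟩]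
  have hscalar : ∀ (g : Matrix.SpecialLinearGroup (Fin 2) F) (m : F), m ≠ 0 →
      (∀ v, v ≠ 0 → Φ g (π v) = π (m • v)) → g ∈ Subgroup.center _ ∧ IsSquare m := by
    intro g m hm hg
    have hsc := eq_scalar_of_crossDet_mulVec (M := g.1) fun v hv => by
      have h1 := h.crossDet_eq_zero (mulVec_ne_zero (by simp [g.2]) hv) (smul_ne_zero hm hv)
        ((hΦ g v hv).symm.trans (hg v hv))
      rw [crossDet_smul_right] at h1
      exact (mul_eq_zero.1 h1).resolve_left hm
    set a := g.1 0 0 with ha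
    have hdet : a ^ 2 = 1 := by
      have := g.2
      rw [hsc] at this
      simpa using this
    refine ⟨Matrix.SpecialLinearGroup.mem_center_iff.2 ⟨a, by simpa using hdet, hsc.symm⟩, ?_⟩
    obtain ⟨ha0, hsa⟩ := hsq a hdet
    have hv : (![1, 0] : Fin 2 → F) ≠ 0 := fun h => by simpa using congrFun h 0
    have h1 := hg _ hv
    rw [hΦ g _ hv, hsc, scalar_mulVec] at h1
    have h2 := h.isSquare_of_smul_eq (t := a * m⁻¹) (smul_ne_zero hm hv)
      (mul_ne_zero ha0 (inv_ne_zero hm)) (by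
        rw [smul_smul, mul_assoc, inv_mul_cancel₀ hm, mul_one, h1])
    have h3 := hsa.mul h2.inv
    rwa [mul_inv, inv_inv, mul_inv_cancel_left₀ ha0] at h3
  let Z : Multiplicative (ZMod 2) →* (Γ ≃g Γ) := MonoidHom.mk' (fun s => τ ^ s.toAdd.val) (by
    intro s t
    rw [← pow_add, toAdd_mul, ZMod.val_add, ← pow_eq_pow_mod _ hτ2])
  have hker : Subgroup.center (Matrix.SpecialLinearGroup (Fin 2) F) ≤ Φ.ker := by
    intro g hg
    obtain ⟨a, ha, hga⟩ := Matrix.SpecialLinearGroup.mem_center_iff.1 hg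
    obtain ⟨ha0, b, rfl⟩ := hsq a (by simpa using ha)
    refine h.iso_ext fun v hv => ?_
    rw [hΦ g v hv, ← hga, scalar_mulVec, mul_smul, h.smul_smul_eq (left_ne_zero_of_mul ha0) hv]
    rfl
  have hZ : ∀ s g, Commute (Z s) (Φ g) := fun s g => Commute.pow_left (hcomm g) _
  refine ⟨Z.noncommCoprod (QuotientGroup.lift _ Φ hker) fun s q => ?_, ?_⟩
  · obtain ⟨g, rfl⟩ := QuotientGroup.mk_surjective q
    exact hZ s g
  · rw [injective_iff_map_eq_one]
    rintro ⟨s, q⟩ hsq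
    obtain ⟨g, rfl⟩ := QuotientGroup.mk_surjective q
    have h1 : τ ^ s.toAdd.val * Φ g = 1 := hsq
    have hs2 := ZMod.val_lt s.toAdd
    rcases (by omega : s.toAdd.val = 0 ∨ s.toAdd.val = 1) with h0 | h0
    · rw [h0, pow_zero, one_mul] at h1
      have h2 := (hscalar g 1 one_ne_zero fun v hv => by rw [h1, one_smul]; rfl).1
      rw [(QuotientGroup.eq_one_iff g).2 h2]
      have h3 : s = 1 := (ZMod.val_eq_zero _).1 h0
      rw [h3]
      rfl
    · rw [h0, pow_one] at h1
      have h2 : Φ g = τ := by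
        rw [eq_inv_of_mul_eq_one_right h1]
        exact inv_eq_of_mul_eq_one_left (by rw [← pow_two, hτ2])
      exact absurd (hscalar g n hn fun v hv => by rw [h2, hτ' v hv]).2 hns

end IsDetModel

section Cardinality

variable {p : ℕ} [Fact p.Prime]

theorem card_specialLinearGroup_two :
    Nat.card (Matrix.SpecialLinearGroup (Fin 2) (ZMod p)) = p * (p + 1) * (p - 1) := by
  have hp := (Fact.out : p.Prime).two_le
  have hdet : Function.Surjective (Matrix.GeneralLinearGroup.det : GL (Fin 2) (ZMod p) →* _) := by
    intro u
    refine ⟨Matrix.GeneralLinearGroup.mkOfDetNeZero !![(u : ZMod p), 0; 0, 1] (by simp), ?_⟩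
    ext
    simp [Matrix.GeneralLinearGroup.mkOfDetNeZero]
  have hker : Nat.card (Matrix.SpecialLinearGroup (Fin 2) (ZMod p)) =
      Nat.card (Matrix.GeneralLinearGroup.det : GL (Fin 2) (ZMod p) →* _).ker := by
    refine Nat.card_congr (Equiv.ofBijective
      (fun g => ⟨Matrix.SpecialLinearGroup.toGL g, by simp [MonoidHom.mem_ker]⟩) ⟨?_, ?_⟩)
    · intro g g' h
      exact (Matrix.SpecialLinearGroup.toGL_inj g g').1 (congrArg Subtype.val h)
    · rintro ⟨M, hM⟩
      exact ⟨⟨M.1, congrArg Units.val hM⟩, Subtype.ext (Units.ext rfl)⟩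
  have h1 := Subgroup.card_eq_card_quotient_mul_card_subgroup
    (Matrix.GeneralLinearGroup.det : GL (Fin 2) (ZMod p) →* _).ker
  rw [← hker, Nat.card_congr (QuotientGroup.quotientKerEquivOfSurjective _ hdet).toEquiv,
    Nat.card_eq_fintype_card (α := (ZMod p)ˣ), ZMod.card_units, Matrix.card_GL_field,
    Fin.prod_univ_two, ZMod.card] at h1
  obtain ⟨q, rfl⟩ : ∃ q, p = q + 1 := ⟨p - 1, by omega⟩
  have e1 : (q + 1) ^ 2 - (q + 1) ^ ((0 : Fin 2) : ℕ) = q * (q + 2) := by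
    have : (q + 1) ^ 2 = q * (q + 2) + 1 := by ring
    simp [this]
  have e2 : (q + 1) ^ 2 - (q + 1) ^ ((1 : Fin 2) : ℕ) = q * (q + 1) := by
    have : (q + 1) ^ 2 = q * (q + 1) + (q + 1) := by ring
    simp [this]
  rw [e1, e2, Nat.add_sub_cancel] at h1
  rw [Nat.add_sub_cancel]
  refine Nat.eq_of_mul_eq_mul_left (by omega : 0 < q) (h1.symm.trans (by ring))

theorem card_center_specialLinearGroup_two_le :
    Nat.card (Subgroup.center (Matrix.SpecialLinearGroup (Fin 2) (ZMod p))) ≤ 2 := by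
  rw [Nat.card_congr (Matrix.SpecialLinearGroup.center_equiv_rootsOfUnity' (0 : Fin 2)).toEquiv,
    Fintype.card_fin]
  exact card_rootsOfUnity _ _

theorem le_card_prod_projectiveSpecialLinearGroup_two :
    p * (p + 1) * (p - 1) ≤ Nat.card (Multiplicative (ZMod 2) ×
      (Matrix.SpecialLinearGroup (Fin 2) (ZMod p) ⧸
        Subgroup.center (Matrix.SpecialLinearGroup (Fin 2) (ZMod p)))) := by
  rw [← card_specialLinearGroup_two, Subgroup.card_eq_card_quotient_mul_card_subgroup
    (Subgroup.center (Matrix.SpecialLinearGroup (Fin 2) (ZMod p))), Nat.card_prod, mul_comm,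
    Nat.card_congr Multiplicative.toAdd, Nat.card_zmod]
  exact Nat.mul_le_mul_right _ card_center_specialLinearGroup_two_le

end Cardinality

namespace IsLocallyPaley

variable {V : Type*} [Fintype V] [DecidableEq V] {Γ : SimpleGraph V} [DecidableRel Γ.Adj]
  {p r : ℕ} [Fact p.Prime]

theorem adj_exists (h : IsLocallyPaley Γ p r) (u : V) : ∃ v, Γ.Adj u v := by
  obtain ⟨e, -⟩ := h.coordinate u
  exact ⟨e 0, (e 0).2⟩

theorem eq_of_forall_adj_iff (h : IsLocallyPaley Γ p r) {x y : V}
    (hxy : ∀ z, Γ.Adj x z ↔ Γ.Adj y z) : x = y := by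
  by_contra hne
  have hnadj : ¬ Γ.Adj x y := fun h' => Γ.irrefl ((hxy y).1 h')
  obtain ⟨v, hv⟩ := h.adj_exists x
  have h1 := h.card_common_distTwo x y ⟨hne, hnadj, v, hv, ((hxy v).1 hv).symm⟩
  simp only [← hxy, and_self, h.card_neighbors] at h1
  have h2 := h.two_mul_add_one
  have := h.pos
  omega

/-- The automorphism group is semiregular on 2-geodesics. -/
theorem card_iso_le (h : IsLocallyPaley Γ p r) (hconn : Γ.Connected)
    (h2 : TwoGeodesicTransitive Γ) (hex : ∃ v u w, Is2Geodesic Γ v u w)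
    (hrigid : ∀ (φ : Γ ≃g Γ) (v u w : V), Is2Geodesic Γ v u w → φ v = v → φ u = u → φ w = w →
      ∀ x, φ x = x) :
    Nat.card (Γ ≃g Γ) ≤ p * (p + 1) * (p - 1) := by
  obtain ⟨v, u, w, hg⟩ := hex
  have hp := h.two_mul_add_one
  let S : Finset (Σ _ : V, Σ _ : V, V) := Finset.univ.sigma fun u =>
    ({v | Γ.Adj u v} : Finset V).sigma fun v => ({x | Γ.Adj u x ∧ x ≠ v ∧ ¬ Γ.Adj v x} : Finset V)
  have hS : S.card = p * (p + 1) * (p - 1) := by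
    have h3 : ∀ u, (({v | Γ.Adj u v} : Finset V).sigma fun v =>
        ({x | Γ.Adj u x ∧ x ≠ v ∧ ¬ Γ.Adj v x} : Finset V)).card = p * r := by
      intro u
      rw [Finset.card_sigma, Finset.sum_congr rfl (g := fun _ => r) fun v hv =>
        h.card_nonadj u v (by simpa using hv), Finset.sum_const, h.card_neighbors, smul_eq_mul]
    rw [Finset.card_sigma]
    simp only [h3, Finset.sum_const, Finset.card_univ, h.card_eq hconn h2, smul_eq_mul]
    rw [← hp, Nat.add_sub_cancel]
    ring
  have : Finite (Γ ≃g Γ) :=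
    Finite.of_injective (fun φ => (φ : V → V)) DFunLike.coe_injective
  have : Fintype (Γ ≃g Γ) := Fintype.ofFinite _
  rw [← hS, Nat.card_eq_fintype_card, ← Finset.card_univ]
  refine Finset.card_le_card_of_injOn (fun φ => ⟨φ u, φ v, φ w⟩) ?_ ?_
  · intro φ _
    obtain ⟨h3, h4, h5, h6⟩ := hg
    simp [S, φ.map_adj_iff, h3.symm, h4, h5.symm, h6]
  · intro φ _ ψ _ hφψ
    simp only [Sigma.mk.injEq, heq_eq_eq] at hφψ
    obtain ⟨h3, h4, h5⟩ := hφψ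
    ext x
    have := hrigid (φ.trans ψ.symm) v u w hg (by simp [h4]) (by simp [h3]) (by simp [h5]) x
    simpa [RelIso.symm_apply_eq] using this

/-- A double cover of the complete graph which is locally a Paley graph has vertices represented by
the vectors of a plane. -/
theorem exists_isDetModel (h : IsLocallyPaley Γ p r) (hconn : Γ.Connected)
    (h2 : TwoGeodesicTransitive Γ) : ∃ π : (Fin 2 → ZMod p) → V, IsDetModel Γ π := by
  classical
  obtain ⟨τ, hτ2, hτne, hτn, hτ⟩ := h.exists_antipodal_map hconn h2
  obtain ⟨c⟩ := hconn.nonempty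
  obtain ⟨e, he⟩ := h.coordinate c
  obtain ⟨n, hn, hns⟩ := exists_not_isSquare_zmod (p := p)
    (by rintro rfl; exact absurd h.mod_four (by decide))
  let T : Prop → V → V := fun P x => if P then x else τ x
  have hTself : ∀ P Q x, ¬ Γ.Adj (T P x) (T Q x) := by
    intro P Q x
    by_cases hP : P <;> by_cases hQ : Q <;> simp [T, hP, hQ, hτn, Γ.adj_comm (τ x) x]
  have hT : ∀ P Q x y, x ≠ y → x ≠ τ y → (Γ.Adj (T P x) (T Q y) ↔ (Γ.Adj x y ↔ (P ↔ Q))) := by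
    intro P Q x y hxy hxy'
    have hyx : y ≠ τ x := fun h' => hxy' (by rw [h', hτ2])
    have h3 := hτ x y hxy.symm hyx
    have h4 := hτ y x hxy hxy'
    have h5 := hτ x (τ y) hxy'.symm (fun h' => hxy (by rw [← hτ2 x, ← h', hτ2]))
    rw [Γ.adj_comm _ x, Γ.adj_comm y] at h4
    by_cases hP : P <;> by_cases hQ : Q <;> simp only [T, hP, hQ, if_true, if_false] <;> tauto
  have hce : ∀ x, Γ.Adj c (e x) := fun x => (e x).2
  have hceτ : ∀ x, c ≠ τ (e x) := fun x h' => hτn (e x) (h' ▸ (hce x).symm)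
  have hne : ∀ x y, x ≠ y → (e x : V) ≠ e y := fun x y hxy h' =>
    hxy (e.injective (Subtype.val_injective h'))
  have hneτ : ∀ x y, (e x : V) ≠ τ (e y) := by
    intro x y h'
    refine (hτ (e y) c (hce y).ne (hceτ y)).1 ?_ (hce y).symm
    rw [← h']
    exact (hce x).symm
  let π : (Fin 2 → ZMod p) → V := fun v =>
    if v 1 = 0 then T (IsSquare (v 0)) c else T (IsSquare (v 1)) (e (v 0 / v 1))
  refine ⟨π, ?_, ?_, fun x y => h.eq_of_forall_adj_iff⟩
  · intro x
    have hcoord : ∀ y, Γ.Adj c y → ∃ t, (e t : V) = y := fun y hy => ⟨e.symm ⟨y, hy⟩, by simp⟩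
    by_cases hxc : x = c
    · exact ⟨![1, 0], fun h' => by simpa using congrFun h' 0, by simp [π, T, hxc]⟩
    by_cases hxτ : x = τ c
    · exact ⟨![n, 0], fun h' => hn (by simpa using congrFun h' 0), by simp [π, T, hns, hxτ]⟩
    by_cases hcx : Γ.Adj c x
    · obtain ⟨t, rfl⟩ := hcoord x hcx
      exact ⟨![t, 1], fun h' => by simpa using congrFun h' 1, by simp [π, T]⟩
    · obtain ⟨t, ht⟩ := hcoord (τ x)
        (((hτ x c (Ne.symm hxc) fun h' => hxτ (by rw [h', hτ2])).2 fun h' => hcx h'.symm).symm)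
      exact ⟨![t * n, n], fun h' => hn (by simpa using congrFun h' 1), by
        simp [π, T, hn, hns, ht, hτ2]⟩
  · have key : ∀ v w : Fin 2 → ZMod p, v ≠ 0 → v 1 = 0 → w 1 ≠ 0 →
        (Γ.Adj (π v) (π w) ↔ crossDet v w ≠ 0 ∧ IsSquare (crossDet v w)) := by
      intro v w hv hv1 hw1
      have hv0 : v 0 ≠ 0 := by
        intro hv0
        apply hv
        ext i
        fin_cases i <;> simp [hv0, hv1]
      simp only [π, hv1, hw1, if_true, if_false, crossDet, zero_mul, sub_zero]
      rw [hT _ _ _ _ (hce _).ne (hceτ _), isSquare_mul_iff hv0 hw1]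
      simp [hce, hv0, hw1]
    intro v w hv hw
    by_cases hv1 : v 1 = 0 <;> by_cases hw1 : w 1 = 0
    · simp [π, hv1, hw1, crossDet, hTself]
    · exact key v w hv hv1 hw1
    · have hcomm : crossDet v w = - crossDet w v := by
        simp only [crossDet]
        ring
      rw [Γ.adj_comm, key w v hw hw1 hv1, hcomm, neg_ne_zero,
        isSquare_neg_iff_of_mod_four h.mod_four]
    · have hdet : crossDet v w = v 1 * w 1 * (v 0 / v 1 - w 0 / w 1) := by
        simp only [crossDet]
        field_simp
      simp only [π, hv1, hw1, if_false, hdet]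
      rcases eq_or_ne (v 0 / v 1) (w 0 / w 1) with hxy | hxy
      · simp [hxy, hTself]
      · have hxy' := sub_ne_zero.2 hxy
        rw [hT _ _ _ _ (hne _ _ hxy) (hneτ _ _), he, isSquare_mul_iff (mul_ne_zero hv1 hw1) hxy',
          isSquare_mul_iff hv1 hw1, and_iff_right hxy,
          and_iff_right (mul_ne_zero (mul_ne_zero hv1 hw1) hxy')]
        tauto

end IsLocallyPaley

theorem stmt15 {V : Type*} [Fintype V] (Γ : SimpleGraph V) (p : ℕ)
    (hp : p.Prime)
    (hreg : ∀ v : V, Nat.card (Γ.neighborSet v) = p)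
    (hconn : Γ.Connected)
    (hnc : Γ ≠ ⊤)
    (h2gt : TwoGeodesicTransitive Γ)
    (h2at : ¬ TwoArcTransitive Γ) :
    Nonempty ((Γ ≃g Γ) ≃*
      Multiplicative (ZMod 2) ×
        (Matrix.SpecialLinearGroup (Fin 2) (ZMod p) ⧸
          Subgroup.center (Matrix.SpecialLinearGroup (Fin 2) (ZMod p)))) ∧
    Nat.card (Γ ≃g Γ) = p * (p + 1) * (p - 1) := by
  classical
  have := Fact.mk hp
  have := hconn.nonempty
  have hN : ∀ u, ({x | Γ.Adj u x} : Finset V).card = p := fun u => by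
    rw [← hreg u, Nat.card_eq_fintype_card, Γ.card_neighborSet_eq_degree,
      ← Γ.card_neighborFinset_eq_degree, Γ.neighborFinset_eq_filter]
  have hnb : ∀ u, ∃ v, Γ.Adj u v := by
    intro u
    obtain ⟨v, hv⟩ := Finset.card_pos.1 (by rw [hN u]; exact hp.pos)
    exact ⟨v, by simpa using hv⟩
  have hgeo := exists_is2Geodesic hconn hnc
  have hnon := exists_neighbors_of_arcTransitive h2gt.1 hnb Not hgeo
  have htri := exists_neighbors_of_arcTransitive h2gt.1 hnb id (exists_triangle h2gt h2at)
  have hloc : ∀ u, ∃ e : ZMod p ≃ Γ.neighborSet u, IsLocalCoordinate Γ u e := fun u =>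
    exists_isLocalCoordinate (hreg u) h2gt.1 (hnon u) (htri u)
  obtain ⟨r, h⟩ := exists_isLocallyPaley hN h2gt hloc hnon htri
  have htri' : ∀ u v, Γ.Adj u v → ∃ w, Γ.Adj u w ∧ Γ.Adj v w := by
    intro u v huv
    obtain ⟨v', w', h1, h2, -, h3⟩ := htri u
    obtain ⟨φ, hu, rfl⟩ := h2gt.1 h1 huv
    refine ⟨φ w', ?_, φ.map_adj_iff.2 h3⟩
    rw [← hu]
    exact φ.map_adj_iff.2 h2
  have hle := h.card_iso_le hconn h2gt hgeo fun φ v u w hg hv hu hw =>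
    eq_refl_of_apply_eq_self hconn hloc htri' hu hg.1.symm hg.2.1 hg.2.2.1 hv hw
  have hge := le_card_prod_projectiveSpecialLinearGroup_two (p := p)
  obtain ⟨π, hπ⟩ := h.exists_isDetModel hconn h2gt
  obtain ⟨n, hn, hns⟩ := exists_not_isSquare_zmod (p := p)
    (by rintro rfl; exact absurd h.mod_four (by decide))
  obtain ⟨Ψ, hΨ⟩ := hπ.exists_injective_hom
    ((isSquare_neg_iff_of_mod_four h.mod_four 1).2 .one) hn hns
  have : Finite (Γ ≃g Γ) := Finite.of_injective (fun φ => (φ : V → V)) DFunLike.coe_injective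
  have hbij := hΨ.bijective_of_nat_card_le (hle.trans hge)
  refine ⟨⟨(MulEquiv.ofBijective Ψ hbij).symm⟩, hle.antisymm ?_⟩
  rwa [← Nat.card_congr (Equiv.ofBijective Ψ hbij)]
end

section
/- Let Γ be a finite arc-transitive graph with a prime number p of vertices, regular of valency (p-1)/2. Then p ≡ 1 (mod 4), Aut Γ has order p(p-1)/2 (and is isomorphic to the semidirect product Z_p : Z_{(p-1)/2}), and Γ is isomorphic to the Paley graph P(p). -/
open SimpleGraph

/-- The Paley graph on the field `F`: distinct `u`, `v` are adjacent iff `u - v` is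
a nonzero square (symmetrised via `fromRel`; when `|F| ≡ 1 (mod 4)` the relation is
already symmetric, since `-1` is then a square). -/
def paleyGraph (F : Type*) [Field F] : SimpleGraph F :=
  SimpleGraph.fromRel (fun u v => ∃ x : F, x ≠ 0 ∧ u - v = x ^ 2)

open Polynomial in
/-- `f` is represented by a polynomial of degree less than `k`. -/
def IsPolyOfDegreeLT {p : ℕ} (k : ℕ) (f : ZMod p → ZMod p) : Prop :=
  ∃ P : (ZMod p)[X], P.degree < k ∧ ∀ x, P.eval x = f x

/-- The operator summing the differences of `f` over all steps in `D`. -/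
def differenceSum {p : ℕ} (D : Finset (ZMod p)) (f : ZMod p → ZMod p) : ZMod p → ZMod p :=
  fun x => ∑ d ∈ D, (f (x + d) - f x)

section Polynomials

open Polynomial

variable {p : ℕ} [Fact p.Prime]

theorem eq_of_degree_lt_of_eval_eq {P Q : (ZMod p)[X]} (hP : P.degree < p) (hQ : Q.degree < p)
    (h : ∀ x, P.eval x = Q.eval x) : P = Q := by
  refine Polynomial.eq_of_degrees_lt_of_eval_finset_eq Finset.univ ?_ ?_ (fun x _ => h x)
  · simpa [ZMod.card] using hP
  · simpa [ZMod.card] using hQ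

theorem isPolyOfDegreeLT_prime (f : ZMod p → ZMod p) : IsPolyOfDegreeLT p f := by
  refine ⟨Lagrange.interpolate Finset.univ id f, ?_, fun x => ?_⟩
  · simpa [ZMod.card] using
      Lagrange.degree_interpolate_lt (s := Finset.univ) (v := id) f Function.injective_id.injOn
  · exact Lagrange.eval_interpolate_at_node (s := Finset.univ) (v := id) f
      Function.injective_id.injOn (Finset.mem_univ x)

theorem isPolyOfDegreeLT_zero_iff (f : ZMod p → ZMod p) : IsPolyOfDegreeLT 0 f ↔ f = 0 := by
  constructor
  · rintro ⟨P, hP, h⟩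
    have : P = 0 := by simpa using hP
    ext x
    simp [← h, this]
  · rintro rfl
    exact ⟨0, by simp, by simp⟩

theorem IsPolyOfDegreeLT.mul {a b : ℕ} {f g : ZMod p → ZMod p} (hf : IsPolyOfDegreeLT (a + 1) f)
    (hg : IsPolyOfDegreeLT b g) : IsPolyOfDegreeLT (a + b) (f * g) := by
  obtain ⟨P, hP, hPf⟩ := hf
  obtain ⟨Q, hQ, hQg⟩ := hg
  refine ⟨P * Q, ?_, fun x => by simp [hPf, hQg]⟩
  rw [degree_lt_iff_coeff_zero] at *
  intro n hn
  rw [coeff_mul]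
  refine Finset.sum_eq_zero fun ij hij => ?_
  have hsum : ij.1 + ij.2 = n := by simpa using hij
  by_cases h1 : a + 1 ≤ ij.1
  · rw [hP _ h1, zero_mul]
  · rw [hQ _ (by omega), mul_zero]

theorem IsPolyOfDegreeLT.of_forall_mul {m k : ℕ} (hm : 1 ≤ m) (hmk : m + k < p)
    {f : ZMod p → ZMod p}
    (h : ∀ g, IsPolyOfDegreeLT m g → IsPolyOfDegreeLT (m + k) (f * g)) :
    IsPolyOfDegreeLT (k + 1) f := by
  obtain ⟨P, hP, hPf⟩ := isPolyOfDegreeLT_prime f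
  refine ⟨P, ?_, hPf⟩
  by_contra hdeg
  have hP0 : P ≠ 0 := by
    rintro rfl
    simp at hdeg
  have hn : k + 1 ≤ P.natDegree := by
    rw [degree_eq_natDegree hP0] at hdeg
    exact_mod_cast not_lt.mp hdeg
  have hnp : P.natDegree < p := by
    rw [degree_eq_natDegree hP0] at hP
    exact_mod_cast hP
  obtain ⟨Q, hQ, hQf⟩ := h (fun x => x ^ (m + k - P.natDegree))
    ⟨X ^ (m + k - P.natDegree), by rw [degree_X_pow]; exact_mod_cast (by omega), by simp⟩
  have hdegPX : (P * X ^ (m + k - P.natDegree)).degree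
      = ((P.natDegree + (m + k - P.natDegree) : ℕ) : WithBot ℕ) := by
    rw [degree_mul, degree_X_pow, degree_eq_natDegree hP0]
    simp
  have hPQ : P * X ^ (m + k - P.natDegree) = Q := by
    refine eq_of_degree_lt_of_eval_eq ?_ (hQ.trans (by exact_mod_cast hmk)) fun x => ?_
    · rw [hdegPX]
      exact_mod_cast (by omega)
    · simp [hQf, hPf]
  rw [← hPQ, hdegPX] at hQ
  have : P.natDegree + (m + k - P.natDegree) < m + k := by exact_mod_cast hQ
  omega

theorem coeff_sum_taylor_sub_s17 (D : Finset (ZMod p)) {P : (ZMod p)[X]} (hP : P.degree < p) (i : ℕ) :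
    (∑ d ∈ D, (taylor d P - P)).coeff i =
      ∑ j ∈ Finset.range p,
        ((j + 1 + i).choose i : ZMod p) * P.coeff (j + 1 + i) * ∑ d ∈ D, d ^ (j + 1) := by
  have key (d : ZMod p) : (taylor d P - P).coeff i = ∑ j ∈ Finset.range p,
      ((j + 1 + i).choose i : ZMod p) * P.coeff (j + 1 + i) * d ^ (j + 1) := by
    have hdeg : (hasseDeriv i P).natDegree < p + 1 := by
      have h1 := natDegree_hasseDeriv_le P i
      have h2 : P.natDegree ≤ p := natDegree_le_of_degree_le hP.le
      omega
    rw [coeff_sub, taylor_coeff, eval_eq_sum_range' hdeg, Finset.sum_range_succ']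
    simp [hasseDeriv_coeff]
  rw [finsetSum_coeff, Finset.sum_congr rfl fun d _ => key d, Finset.sum_comm]
  simp_rw [Finset.mul_sum]

/-- If `m` is the first exponent with nonvanishing power sum over `D`, then `differenceSum D`
lowers the degree by exactly `m`. -/
theorem isPolyOfDegreeLT_differenceSum_iff {D : Finset (ZMod p)} {m : ℕ} (hm : 1 ≤ m)
    (hsm : ∑ d ∈ D, d ^ m ≠ 0) (hs : ∀ j, 1 ≤ j → j < m → ∑ d ∈ D, d ^ j = 0) {k : ℕ}
    (hkp : k ≤ p) (f : ZMod p → ZMod p) :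
    IsPolyOfDegreeLT k (differenceSum D f) ↔ IsPolyOfDegreeLT (k + m) f := by
  obtain ⟨P, hP, hPf⟩ := isPolyOfDegreeLT_prime f
  have heval (P : (ZMod p)[X]) (hPf : ∀ x, P.eval x = f x) (x : ZMod p) :
      (∑ d ∈ D, (taylor d P - P)).eval x = differenceSum D f x := by
    simp [eval_finsetSum, differenceSum, taylor_eval, hPf]
  have hterm (i j : ℕ) (h : P.coeff (j + 1 + i) = 0 ∨ j + 1 < m) :
      ((j + 1 + i).choose i : ZMod p) * P.coeff (j + 1 + i) * ∑ d ∈ D, d ^ (j + 1) = 0 := by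
    obtain h | h := h
    · simp [h]
    · simp [hs (j + 1) (by omega) h]
  have hlow (l : ℕ) (hl : P.degree < (l + m : ℕ)) :
      (∑ d ∈ D, (taylor d P - P)).degree < l := by
    rw [degree_lt_iff_coeff_zero] at hl ⊢
    intro i hi
    rw [coeff_sum_taylor_sub_s17 D hP]
    refine Finset.sum_eq_zero fun j _ => hterm i j ?_
    by_cases hj : j + 1 < m
    · exact Or.inr hj
    · exact Or.inl (hl _ (by omega))
  constructor
  · rintro ⟨Q, hQ, hQf⟩
    refine ⟨P, ?_, hPf⟩
    by_contra hdeg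
    have hP0 : P ≠ 0 := by
      rintro rfl
      simp at hdeg
    have hn : k + m ≤ P.natDegree := by
      rw [degree_eq_natDegree hP0] at hdeg
      exact_mod_cast not_lt.mp hdeg
    have hnp : P.natDegree < p := by
      rw [degree_eq_natDegree hP0] at hP
      exact_mod_cast hP
    have hEQ : ∑ d ∈ D, (taylor d P - P) = Q := by
      refine eq_of_degree_lt_of_eval_eq (hlow p (hP.trans_le (by exact_mod_cast Nat.le_add_right p m)))
        (hQ.trans_le (by exact_mod_cast hkp)) fun x => ?_
      rw [heval P hPf, hQf]
    have hc : (∑ d ∈ D, (taylor d P - P)).coeff (P.natDegree - m) = 0 := by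
      rw [hEQ]
      exact (degree_lt_iff_coeff_zero _ _).mp hQ _ (by omega)
    rw [coeff_sum_taylor_sub_s17 D hP, Finset.sum_eq_single (m - 1)] at hc
    · have e1 : m - 1 + 1 = m := by omega
      have e2 : m + (P.natDegree - m) = P.natDegree := by omega
      rw [e1, e2] at hc
      have hchoose : ((P.natDegree.choose (P.natDegree - m) : ℕ) : ZMod p) ≠ 0 := by
        rw [Ne, ZMod.natCast_eq_zero_iff]
        intro hdvd
        have hfac : p ∣ P.natDegree.factorial := by
          rw [← Nat.choose_mul_factorial_mul_factorial (Nat.sub_le P.natDegree m), mul_assoc]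
          exact hdvd.mul_right _
        have := (Fact.out : p.Prime).dvd_factorial.mp hfac
        omega
      exact mul_ne_zero (mul_ne_zero hchoose (leadingCoeff_ne_zero.mpr hP0)) hsm hc
    · intro j _ hj
      refine hterm _ j ?_
      by_cases hjm : j + 1 < m
      · exact Or.inr hjm
      · exact Or.inl (coeff_eq_zero_of_natDegree_lt (by omega))
    · intro h
      simp at h
      omega
  · rintro ⟨Q, hQ, hQf⟩
    refine ⟨∑ d ∈ D, (taylor d P - P), hlow k ?_, heval P hPf⟩
    by_cases hkm : k + m < p
    · rwa [eq_of_degree_lt_of_eval_eq hP (hQ.trans (by exact_mod_cast hkm))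
        fun x => (hPf x).trans (hQf x).symm]
    · exact hP.trans_le (by exact_mod_cast not_lt.mp hkm)

theorem exists_sum_pow_ne_zero_s17 {D : Finset (ZMod p)} (h0 : 0 ∉ D) (hD : D.Nonempty) :
    ∃ m, 1 ≤ m ∧ m ≤ D.card ∧ ∑ d ∈ D, d ^ m ≠ 0 := by
  by_contra! h
  obtain ⟨d₀, hd₀⟩ := hD
  set Q : (ZMod p)[X] := ∏ d ∈ D.erase d₀, (X - C d)
  have hQdeg : Q.natDegree < D.card := by
    have : Q.natDegree = (D.erase d₀).card := natDegree_finsetProd_X_sub_C_eq_card _ _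
    rw [this]
    exact Finset.card_erase_lt_of_mem hd₀
  have hsum : ∑ d ∈ D, d * Q.eval d = 0 := by
    simp_rw [eval_eq_sum_range' hQdeg, Finset.mul_sum]
    rw [Finset.sum_comm]
    refine Finset.sum_eq_zero fun j hj => ?_
    have := h (j + 1) (by omega) (by simp at hj; omega)
    rw [← mul_zero (Q.coeff j), ← this, Finset.mul_sum]
    exact Finset.sum_congr rfl fun d _ => by ring
  rw [Finset.sum_eq_single_of_mem d₀ hd₀] at hsum
  · refine mul_ne_zero (fun h => h0 (h ▸ hd₀)) ?_ hsum
    rw [eval_prod, Finset.prod_ne_zero_iff]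
    intro d hd
    simpa [sub_eq_zero] using (Finset.ne_of_mem_erase hd).symm
  · intro d hd hne
    rw [eval_prod, Finset.prod_eq_zero (Finset.mem_erase.mpr ⟨hne, hd⟩) (by simp), mul_zero]

theorem differenceSum_comp {D : Finset (ZMod p)} (π : Equiv.Perm (ZMod p))
    (hπ : ∀ x y, π y - π x ∈ D ↔ y - x ∈ D) (f : ZMod p → ZMod p) :
    differenceSum D (f ∘ π) = differenceSum D f ∘ π := by
  ext x
  refine Finset.sum_nbij' (fun d => π (x + d) - π x) (fun d => π.symm (π x + d) - x) ?_ ?_ ?_ ?_ ?_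
  · intro d hd
    simpa [hπ] using hd
  · intro d hd
    simpa [← hπ] using hd
  all_goals intros; simp

/-- A permutation of `ZMod p` preserving a small Cayley relation is affine. -/
theorem exists_affine_of_preserves {D : Finset (ZMod p)} (h0 : 0 ∉ D) (hD : D.Nonempty)
    (hcard : 2 * D.card < p) (π : Equiv.Perm (ZMod p))
    (hπ : ∀ x y, π y - π x ∈ D ↔ y - x ∈ D) : ∃ a b, ∀ x, π x = a * x + b := by
  classical
  have hex := exists_sum_pow_ne_zero_s17 h0 hD
  obtain ⟨hm, hmD, hsm⟩ := Nat.find_spec hex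
  set m := Nat.find hex
  have hs (j : ℕ) (hj : 1 ≤ j) (hjm : j < m) : ∑ d ∈ D, d ^ j = 0 := by
    by_contra hne
    exact Nat.find_min hex hjm ⟨hj, by omega, hne⟩
  have hinv1 (f : ZMod p → ZMod p) : IsPolyOfDegreeLT m (f ∘ π) ↔ IsPolyOfDegreeLT m f := by
    have key (g : ZMod p → ZMod p) : IsPolyOfDegreeLT m g ↔ differenceSum D g = 0 := by
      rw [← isPolyOfDegreeLT_zero_iff,
        isPolyOfDegreeLT_differenceSum_iff hm hsm hs (Nat.zero_le p), zero_add]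
    rw [key, key, differenceSum_comp π hπ]
    exact ⟨fun h => π.surjective.injective_comp_right (h.trans rfl), fun h => by rw [h]; rfl⟩
  have hinv2 (f : ZMod p → ZMod p) (hf : IsPolyOfDegreeLT (m + m) f) :
      IsPolyOfDegreeLT (m + m) (f ∘ π) := by
    rw [← isPolyOfDegreeLT_differenceSum_iff hm hsm hs (by omega)] at hf ⊢
    rwa [differenceSum_comp π hπ, hinv1]
  have hsucc (f : ZMod p → ZMod p) (hf : IsPolyOfDegreeLT (m + 1) f) :
      IsPolyOfDegreeLT (m + 1) (f ∘ π) := by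
    refine IsPolyOfDegreeLT.of_forall_mul hm (by omega) fun g hg => ?_
    have hg' : IsPolyOfDegreeLT m (g ∘ π.symm) := by
      rw [← hinv1]
      simpa [Function.comp_assoc] using hg
    convert hinv2 _ (hf.mul hg') using 1
    ext x
    simp
  have htwo : IsPolyOfDegreeLT (1 + 1) (id ∘ π) := by
    refine IsPolyOfDegreeLT.of_forall_mul hm (by omega) fun g hg => ?_
    have hg' : IsPolyOfDegreeLT m (g ∘ π.symm) := by
      rw [← hinv1]
      simpa [Function.comp_assoc] using hg
    have hid : IsPolyOfDegreeLT (1 + 1) (id : ZMod p → ZMod p) :=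
      ⟨X, by rw [degree_X]; exact_mod_cast one_lt_two, by simp⟩
    have hmul := hid.mul hg'
    rw [add_comm] at hmul
    convert hsucc _ hmul using 1
    ext x
    simp
  obtain ⟨P, hP, hPπ⟩ := htwo
  refine ⟨P.coeff 1, P.coeff 0, fun x => ?_⟩
  have hP1 : P.degree ≤ 1 := by
    rw [degree_le_iff_coeff_zero]
    intro n hn
    exact (degree_lt_iff_coeff_zero _ _).mp hP n (by exact_mod_cast hn)
  have := hPπ x
  rw [eq_X_add_C_of_degree_le_one hP1] at this
  simpa using this.symm

end Polynomials

section Automorphisms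

/-- Isomorphic graphs have isomorphic automorphism groups. -/
def autCongr {V W : Type*} {Γ : SimpleGraph V} {Δ : SimpleGraph W} (e : Γ ≃g Δ) :
    (Γ ≃g Γ) ≃* (Δ ≃g Δ) where
  toFun φ := (e.symm.trans φ).trans e
  invFun φ := (e.trans φ).trans e.symm
  left_inv φ := by ext; simp
  right_inv φ := by ext; simp
  map_mul' φ ψ := by ext; simp

theorem ArcTransitive.congr {V W : Type*} {Γ : SimpleGraph V} {Δ : SimpleGraph W} (e : Γ ≃g Δ)
    (h : ArcTransitive Γ) : ArcTransitive Δ := by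
  intro v u v' u' hvu hvu'
  obtain ⟨φ, h1, h2⟩ := h (e.symm.map_adj_iff.mpr hvu) (e.symm.map_adj_iff.mpr hvu')
  exact ⟨autCongr e φ, by simp [autCongr, h1], by simp [autCongr, h2]⟩

/-- An automorphism of prime order identifies a graph on `p` vertices with a graph on `ZMod p`
for which translations are automorphisms. -/
theorem exists_iso_translationInvariant {V : Type*} [Fintype V] {Γ : SimpleGraph V} {p : ℕ}
    [Fact p.Prime] (hcard : Nat.card V = p) (σ : Γ ≃g Γ) (hσ : orderOf σ = p) :
    ∃ Δ : SimpleGraph (ZMod p), Nonempty (Γ ≃g Δ) ∧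
      ∀ x y c, Δ.Adj (x + c) (y + c) ↔ Δ.Adj x y := by
  classical
  have hp : p.Prime := Fact.out
  rw [Nat.card_eq_fintype_card] at hcard
  set τ : Equiv.Perm V := MulAction.toPermHom (Γ ≃g Γ) V σ with hτ
  have hτσ (x : V) : τ x = σ x := rfl
  have hord : orderOf τ = p := by
    rw [← hσ]
    exact orderOf_injective _ MulAction.toPerm_injective σ
  have hcyc : τ.IsCycle :=
    Equiv.Perm.isCycle_of_prime_order'' (hcard ▸ hp) (hord.trans hcard.symm)
  have hsupp : τ.support = Finset.univ := by
    rw [← Finset.card_eq_iff_eq_univ, ← hcyc.orderOf, hord, hcard]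
  have hmove (x : V) : τ x ≠ x := by
    rw [← Equiv.Perm.mem_support, hsupp]
    exact Finset.mem_univ x
  obtain ⟨v₀⟩ : Nonempty V := Fintype.card_pos_iff.mp (hcard ▸ hp.pos)
  have hpow (x : ZMod p) (n : ℕ) (hx : x = n) : τ ^ x.val = τ ^ n := by
    rw [pow_eq_pow_iff_modEq, hord, ← ZMod.natCast_eq_natCast_iff, ← hx, ZMod.natCast_zmod_val]
  set f : ZMod p → V := fun x => (τ ^ x.val) v₀ with hf
  have hsurj : Function.Surjective f := by
    intro y
    obtain ⟨i, hi⟩ := hcyc.exists_pow_eq (hmove v₀) (hmove y)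
    exact ⟨i, by rw [hf, ← hi]; simp only [hpow (i : ZMod p) i rfl]⟩
  have hbij : Function.Bijective f :=
    hsurj.bijective_of_nat_card_le (by simp [hcard])
  have hstep (x : ZMod p) : f (x + 1) = σ (f x) := by
    rw [← hτσ, hf]
    simp only
    rw [hpow (x + 1) (x.val + 1) (by simp), pow_succ', Equiv.Perm.mul_apply]
  refine ⟨Γ.comap f, ⟨(SimpleGraph.Iso.comap (Equiv.ofBijective f hbij) Γ).symm⟩, ?_⟩
  intro x y c
  have key (n : ℕ) : (Γ.comap f).Adj (x + n) (y + n) ↔ (Γ.comap f).Adj x y := by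
    induction n with
    | zero => simp
    | succ n ih =>
      rw [← ih]
      simp only [Nat.cast_succ, ← add_assoc, SimpleGraph.comap_adj, hstep]
      exact σ.map_adj_iff
  simpa using key c.val

theorem exists_orderOf_eq_of_arcTransitive {V : Type*} [Fintype V] {Γ : SimpleGraph V} {p : ℕ}
    [Fact p.Prime] (hcard : Nat.card V = p) (hat : ArcTransitive Γ) (hne : ∀ v, ∃ u, Γ.Adj v u) :
    ∃ σ : Γ ≃g Γ, orderOf σ = p := by
  have : Finite (Γ ≃g Γ) :=
    Finite.of_injective (fun φ => (φ : V → V)) DFunLike.coe_injective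
  refine exists_prime_orderOf_dvd_card' p ?_
  have hp : p.Prime := Fact.out
  obtain ⟨v₀⟩ : Nonempty V := (Nat.card_pos_iff.mp (hcard ▸ hp.pos)).1
  have horb : MulAction.orbit (Γ ≃g Γ) v₀ = Set.univ := by
    refine Set.eq_univ_of_forall fun v => ?_
    obtain ⟨u₀, hu₀⟩ := hne v₀
    obtain ⟨u, hu⟩ := hne v
    obtain ⟨φ, hφ, -⟩ := hat hu₀ hu
    exact ⟨φ, hφ⟩
  have := (MulAction.stabilizer (Γ ≃g Γ) v₀).index_dvd_card
  rwa [MulAction.index_stabilizer, horb, Set.ncard_univ, hcard] at this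

end Automorphisms

section Cayley

variable {p : ℕ} [Fact p.Prime]

/-- The units of `ZMod p` acting on `Δ` as automorphisms. -/
def multiplierGroup (Δ : SimpleGraph (ZMod p)) : Subgroup (ZMod p)ˣ where
  carrier := {a | ∀ x y, Δ.Adj (a * x) (a * y) ↔ Δ.Adj x y}
  one_mem' := by simp
  mul_mem' {a b} ha hb x y := by
    rw [Units.val_mul, mul_assoc, mul_assoc, ha, hb]
  inv_mem' {a} ha x y := by
    rw [← ha, Units.mul_inv_cancel_left, Units.mul_inv_cancel_left]

/-- The automorphism `x ↦ a * x + b` of a translation invariant graph. -/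
def affineIso {Δ : SimpleGraph (ZMod p)} (htr : ∀ x y c, Δ.Adj (x + c) (y + c) ↔ Δ.Adj x y)
    (a : multiplierGroup Δ) (b : ZMod p) : Δ ≃g Δ where
  toEquiv := (Units.mulLeft (a : (ZMod p)ˣ)).trans (Equiv.addRight b)
  map_rel_iff' {x y} := by
    simp only [Equiv.trans_apply, Units.mulLeft_apply, Equiv.coe_addRight, htr]
    exact a.2 x y

@[simp]
theorem affineIso_apply {Δ : SimpleGraph (ZMod p)}
    (htr : ∀ x y c, Δ.Adj (x + c) (y + c) ↔ Δ.Adj x y) (a : multiplierGroup Δ) (b x : ZMod p) :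
    affineIso htr a b x = ((a : (ZMod p)ˣ) : ZMod p) * x + b := rfl

theorem exists_eq_affineIso {Δ : SimpleGraph (ZMod p)}
    (htr : ∀ x y c, Δ.Adj (x + c) (y + c) ↔ Δ.Adj x y) (hne : ∃ u, Δ.Adj 0 u)
    (hval : 2 * Nat.card (Δ.neighborSet 0) < p) (φ : Δ ≃g Δ) :
    ∃ a b, φ = affineIso htr a b := by
  classical
  set D : Finset (ZMod p) := (Δ.neighborSet 0).toFinset with hD
  have hmem (x y : ZMod p) : y - x ∈ D ↔ Δ.Adj x y := by
    rw [hD, Set.mem_toFinset, SimpleGraph.mem_neighborSet, ← htr 0 (y - x) x]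
    simp
  obtain ⟨u, hu⟩ := hne
  obtain ⟨a, b, hab⟩ := exists_affine_of_preserves (D := D) (by simp [hD])
    ⟨u, by simpa [hD] using hu⟩ (by rwa [hD, Set.toFinset_card, ← Nat.card_eq_fintype_card])
    φ.toEquiv fun x y => by
      rw [hmem, hmem]
      exact φ.map_adj_iff
  change ∀ x, φ x = a * x + b at hab
  have ha : a ≠ 0 := by
    rintro rfl
    have : φ 0 = φ 1 := by simp [hab]
    exact zero_ne_one (φ.injective this)
  refine ⟨⟨Units.mk0 a ha, fun x y => ?_⟩, b, ?_⟩
  · rw [← φ.map_adj_iff (v := x), hab, hab, htr]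
    rfl
  · ext x
    simp [hab]

theorem nonempty_aut_mulEquiv_semidirectProduct {Δ : SimpleGraph (ZMod p)}
    (htr : ∀ x y c, Δ.Adj (x + c) (y + c) ↔ Δ.Adj x y)
    (haff : ∀ φ : Δ ≃g Δ, ∃ a b, φ = affineIso htr a b) {k : ℕ}
    (hk : Nat.card (multiplierGroup Δ) = k) :
    ∃ φ : Multiplicative (ZMod k) →* MulAut (Multiplicative (ZMod p)),
      Function.Injective φ ∧ Nonempty ((Δ ≃g Δ) ≃* SemidirectProduct (Multiplicative (ZMod p))
        (Multiplicative (ZMod k)) φ) := by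
  let h : Multiplicative (ZMod k) ≃* multiplierGroup Δ :=
    mulEquivOfCyclicCardEq ((Nat.card_zmod k).trans hk.symm)
  let φ : Multiplicative (ZMod k) →* MulAut (Multiplicative (ZMod p)) :=
    (MulAutMultiplicative (ZMod p)).symm.toMonoidHom.comp
      (AddAut.mulLeft.comp ((multiplierGroup Δ).subtype.comp h.toMonoidHom))
  have hφ (g : Multiplicative (ZMod k)) (x : Multiplicative (ZMod p)) :
      (φ g x).toAdd = ((h g : (ZMod p)ˣ) : ZMod p) * x.toAdd := rfl
  refine ⟨φ, fun g g' hgg' => ?_, ⟨MulEquiv.symm (MulEquiv.ofBijective (MonoidHom.mk' (fun s =>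
    affineIso htr (h s.right) s.left.toAdd) fun s t => ?_) ⟨fun s t hst => ?_, fun ψ => ?_⟩)⟩⟩
  · apply h.injective
    ext
    have := hφ g (Multiplicative.ofAdd 1)
    rw [hgg', hφ] at this
    simpa using this.symm
  · ext x
    simp [hφ]
    ring
  · have hst' (x : ZMod p) := DFunLike.congr_fun hst x
    simp only [MonoidHom.mk'_apply, affineIso_apply] at hst'
    have h0 := hst' 0
    have h1 := hst' 1
    simp only [mul_zero, zero_add] at h0
    rw [h0, add_left_inj, mul_one, mul_one] at h1
    ext1
    · exact h0
    · exact h.injective (Subtype.ext (Units.ext h1))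
  · obtain ⟨a, b, rfl⟩ := haff ψ
    exact ⟨⟨Multiplicative.ofAdd b, h.symm a⟩, by ext; simp⟩

theorem exists_multiplier_of_adj {Δ : SimpleGraph (ZMod p)} {d₀ : ZMod p}
    (htr : ∀ x y c, Δ.Adj (x + c) (y + c) ↔ Δ.Adj x y)
    (haff : ∀ φ : Δ ≃g Δ, ∃ a b, φ = affineIso htr a b) (hat : ArcTransitive Δ)
    (hd₀ : Δ.Adj 0 d₀) {d : ZMod p} (hd : Δ.Adj 0 d) :
    ∃ a : multiplierGroup Δ, ((a : (ZMod p)ˣ) : ZMod p) * d₀ = d := by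
  obtain ⟨φ, h0, h1⟩ := hat hd₀ hd
  obtain ⟨a, b, rfl⟩ := haff φ
  refine ⟨a, ?_⟩
  have hb : b = 0 := by simpa using h0
  simpa [hb] using h1

theorem card_multiplierGroup {Δ : SimpleGraph (ZMod p)} {d₀ : ZMod p}
    (htr : ∀ x y c, Δ.Adj (x + c) (y + c) ↔ Δ.Adj x y)
    (haff : ∀ φ : Δ ≃g Δ, ∃ a b, φ = affineIso htr a b) (hat : ArcTransitive Δ)
    (hd₀ : Δ.Adj 0 d₀) :
    Nat.card (multiplierGroup Δ) = Nat.card (Δ.neighborSet 0) := by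
  refine Nat.card_eq_of_bijective (fun a => ⟨((a : (ZMod p)ˣ) : ZMod p) * d₀, ?_⟩) ⟨?_, ?_⟩
  · have := (a.2 0 d₀).mpr hd₀
    rwa [mul_zero] at this
  · intro a b hab
    have := mul_right_cancel₀ hd₀.ne' (Subtype.ext_iff.mp hab)
    exact Subtype.ext (Units.ext this)
  · rintro ⟨d, hd⟩
    obtain ⟨a, ha⟩ := exists_multiplier_of_adj htr haff hat hd₀ hd
    exact ⟨a, Subtype.ext ha⟩

theorem mem_iff_isSquare_of_two_mul_card_eq {H : Subgroup (ZMod p)ˣ}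
    (hH : 2 * Nat.card H = p - 1) (a : (ZMod p)ˣ) : a ∈ H ↔ ∃ y, y ^ 2 = a := by
  classical
  have hp : p.Prime := Fact.out
  have hpos : 0 < Nat.card H := Nat.card_pos
  have hhalf : p / 2 = Nat.card H := by omega
  rw [ZMod.euler_criterion_units, hhalf]
  have hsub : (H : Set (ZMod p)ˣ).toFinset ⊆
      Finset.univ.filter fun a : (ZMod p)ˣ => a ^ Nat.card H = 1 := by
    intro a ha
    rw [Set.mem_toFinset, SetLike.mem_coe] at ha
    exact Finset.mem_filter.mpr
      ⟨Finset.mem_univ a, congrArg Subtype.val (pow_card_eq_one' (x := (⟨a, ha⟩ : H)))⟩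
  have heq := Finset.eq_of_subset_of_card_le hsub <|
    (IsCyclic.card_pow_eq_one_le hpos).trans (by
      rw [Set.toFinset_card, ← Nat.card_eq_fintype_card]; rfl)
  simpa using Finset.ext_iff.mp heq a

theorem nonempty_iso_paleyGraph {Δ : SimpleGraph (ZMod p)} {d₀ : ZMod p}
    (htr : ∀ x y c, Δ.Adj (x + c) (y + c) ↔ Δ.Adj x y)
    (hmul : ∀ d, Δ.Adj 0 d → ∃ a : multiplierGroup Δ, ((a : (ZMod p)ˣ) : ZMod p) * d₀ = d)
    (hsq : ∀ a, a ∈ multiplierGroup Δ ↔ ∃ y, y ^ 2 = a) (hd₀ : Δ.Adj 0 d₀) :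
    Nonempty (Δ ≃g paleyGraph (ZMod p)) := by
  have hd₀' : d₀ ≠ 0 := hd₀.ne'
  have hsub (u v : ZMod p) : Δ.Adj u v ↔ Δ.Adj 0 (v - u) := by
    rw [← htr 0 (v - u) u]
    simp
  have hadj (u v : ZMod p) (h : ∃ x : ZMod p, x ≠ 0 ∧ u - v = x ^ 2) :
      Δ.Adj (d₀ * v) (d₀ * u) := by
    obtain ⟨x, hx, hxuv⟩ := h
    have hmem := (hsq (Units.mk0 x hx ^ 2)).mpr ⟨_, rfl⟩
    have := (hmem 0 d₀).mpr hd₀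
    rw [hsub, ← mul_sub, hxuv]
    simpa [mul_comm] using this
  refine ⟨RelIso.symm ⟨Units.mulLeft (Units.mk0 d₀ hd₀'), fun {u v} => ?_⟩⟩
  change Δ.Adj (d₀ * u) (d₀ * v) ↔ _
  rw [paleyGraph, SimpleGraph.fromRel_adj]
  constructor
  · intro h
    refine ⟨fun huv => h.ne (by rw [huv]), Or.inr ?_⟩
    rw [hsub, ← mul_sub] at h
    obtain ⟨a, ha⟩ := hmul _ h
    obtain ⟨y, hy⟩ := (hsq a).mp a.2
    refine ⟨y, y.ne_zero, mul_left_cancel₀ hd₀' ?_⟩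
    rw [← ha, ← hy, mul_comm]
    simp
  · rintro ⟨-, h | h⟩
    · exact (hadj _ _ h).symm
    · exact hadj _ _ h

end Cayley

theorem stmt17 {V : Type*} [Fintype V] (Γ : SimpleGraph V) (p : ℕ)
    (hp : p.Prime) [Fact p.Prime]
    (hcard : Nat.card V = p)
    (hreg : ∀ v : V, 2 * Nat.card (Γ.neighborSet v) = p - 1)
    (hat : ArcTransitive Γ) :
    p % 4 = 1 ∧
    Nat.card (Γ ≃g Γ) = p * (p - 1) / 2 ∧
    (∃ φ : Multiplicative (ZMod ((p - 1) / 2)) →* MulAut (Multiplicative (ZMod p)),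
      Function.Injective φ ∧
      Nonempty ((Γ ≃g Γ) ≃* SemidirectProduct (Multiplicative (ZMod p))
        (Multiplicative (ZMod ((p - 1) / 2))) φ)) ∧
    Nonempty (Γ ≃g paleyGraph (ZMod p)) := by
  classical
  have hp2 := hp.two_le
  have hdeg (v : V) : Nat.card (Γ.neighborSet v) = (p - 1) / 2 := by
    have := hreg v
    omega
  have hne (v : V) : ∃ u, Γ.Adj v u := by
    have hpos : 0 < Nat.card (Γ.neighborSet v) := by
      have := hreg v
      omega
    obtain ⟨⟨u, hu⟩⟩ := (Nat.card_pos_iff.mp hpos).1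
    exact ⟨u, hu⟩
  obtain ⟨v₀⟩ : Nonempty V := (Nat.card_pos_iff.mp (hcard ▸ hp.pos)).1
  have hmod : p % 4 = 1 := by
    have hsum := Γ.sum_degrees_eq_twice_card_edges
    have hdeg' (v : V) : Γ.degree v = (p - 1) / 2 := by
      rw [← hdeg v, Nat.card_eq_fintype_card, SimpleGraph.card_neighborSet_eq_degree]
    simp only [hdeg', Finset.sum_const, Finset.card_univ, smul_eq_mul] at hsum
    rw [← Nat.card_eq_fintype_card, hcard] at hsum
    have hodd : ¬ 2 ∣ p := by
      have := hreg v₀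
      omega
    have := (Nat.prime_two.dvd_mul.mp ⟨_, hsum⟩).resolve_left hodd
    omega
  obtain ⟨σ, hσ⟩ := exists_orderOf_eq_of_arcTransitive hcard hat hne
  obtain ⟨Δ, ⟨e⟩, htr⟩ := exists_iso_translationInvariant hcard σ hσ
  have hat' := hat.congr e
  have hval : Nat.card (Δ.neighborSet 0) = (p - 1) / 2 := by
    rw [← hdeg (e.symm 0)]
    exact Nat.card_congr (e.symm.mapNeighborSet 0)
  obtain ⟨u, hu⟩ := hne (e.symm 0)
  have hd₀ : Δ.Adj 0 (e u) := by
    simpa using e.map_adj_iff.mpr hu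
  have haff := exists_eq_affineIso htr ⟨_, hd₀⟩ (by omega)
  have hH : Nat.card (multiplierGroup Δ) = (p - 1) / 2 :=
    (card_multiplierGroup htr haff hat' hd₀).trans hval
  obtain ⟨φ, hφ, ⟨ψ⟩⟩ := nonempty_aut_mulEquiv_semidirectProduct htr haff hH
  refine ⟨hmod, ?_, ⟨φ, hφ, ⟨(autCongr e).trans ψ⟩⟩, ?_⟩
  · rw [Nat.card_congr ((autCongr e).trans ψ).toEquiv, SemidirectProduct.card]
    rw [show Nat.card (Multiplicative (ZMod p)) = p from Nat.card_zmod p,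
      show Nat.card (Multiplicative (ZMod ((p - 1) / 2))) = (p - 1) / 2 from Nat.card_zmod _]
    exact (Nat.mul_div_assoc p (by omega)).symm
  · obtain ⟨f⟩ := nonempty_iso_paleyGraph htr
      (fun d hd => exists_multiplier_of_adj htr haff hat' hd₀ hd)
      (mem_iff_isSquare_of_two_mul_card_eq (by omega)) hd₀
    exact ⟨e.trans f⟩
end
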